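/- arXiv:1802.02808 — 4 statements merged into one kernel-verified Lean document; each statement's English description precedes it below -/
import Mathlib

section
/- Let K be a planar convex body with C² boundary and minimal curvature κ_m > 1. For each boundary point x of K, as t → 0⁺, the arc-length ℓ(u_x,t) of the circular part of the boundary of the disc-cap D(u_x,t) of height t with vertex x satisfies lim_{t→0⁺} ℓ(u_x,t)·t^{−1/2} = 2·√(2/(κ(x)−1)). -/
open Metric Filter MeasureTheory
open scoped RealInnerProductSpace Topology

theorem frontier_diff_ball_inter_sphere {V : Type*} [NormedAddCommGroup V] [NormedSpace ℝ V]
    {K : Set V} (hK : IsClosed K) (c : V) {r : ℝ} (hr : r ≠ 0) :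
    frontier (K \ ball c r) ∩ sphere c r = K ∩ sphere c r := by
  have hcl : IsClosed (K \ ball c r) := hK.sdiff isOpen_ball
  rw [hcl.frontier_eq]
  ext y
  constructor
  · rintro ⟨⟨⟨hy, -⟩, -⟩, hs⟩
    exact ⟨hy, hs⟩
  · rintro ⟨hy, hs⟩
    refine ⟨⟨⟨hy, fun h => (mem_ball.1 h).ne (mem_sphere.1 hs)⟩, fun h => ?_⟩, hs⟩
    have h' : y ∈ interior (ball c r)ᶜ := interior_mono (fun z hz => hz.2) h
    rw [interior_compl, closure_ball c hr] at h'
    exact h' (sphere_subset_closedBall hs)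

theorem hausdorffMeasure_le_of_subset_arc {V : Type*} [NormedAddCommGroup V]
    [InnerProductSpace ℝ V] [MeasurableSpace V] [BorelSpace V] {T u : V} (hT : ‖T‖ = 1)
    (hu : ‖u‖ = 1) (hTu : ⟪T, u⟫ = 0) (c : V) {r : ℝ} {A : Set V}
    (hA : A ⊆ (fun φ : ℝ => c + Real.cos φ • u + Real.sin φ • T) '' Set.Icc (-r) r) :
    μH[1] A ≤ ENNReal.ofReal (2 * r) := by
  have hlip : LipschitzWith 1 (fun φ : ℝ => c + Real.cos φ • u + Real.sin φ • T) := by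
    refine LipschitzWith.of_dist_le_mul fun a b => ?_
    rw [dist_eq_norm, Real.dist_eq, NNReal.coe_one, one_mul]
    have h1 : c + Real.cos a • u + Real.sin a • T - (c + Real.cos b • u + Real.sin b • T)
        = (Real.sin a - Real.sin b) • T + (Real.cos a - Real.cos b) • u := by module
    rw [h1]
    refine abs_le_of_sq_le_sq' ?_ (abs_nonneg _) |>.2
    rw [norm_add_sq_real, inner_smul_left, inner_smul_right, hTu, norm_smul, norm_smul, hT, hu,
      sq_abs]
    have h2 := Real.one_sub_sq_div_two_le_cos (x := a - b)
    rw [Real.cos_sub] at h2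
    simp only [Real.norm_eq_abs, mul_one, sq_abs, mul_zero, add_zero]
    nlinarith [Real.sin_sq_add_cos_sq a, Real.sin_sq_add_cos_sq b]
  calc μH[1] A ≤ _ := measure_mono hA
    _ ≤ _ := (hlip.lipschitzOnWith (s := Set.Icc (-r) r)).hausdorffMeasure_image_le zero_le_one
    _ = _ := by
      rw [hausdorffMeasure_real, Real.volume_Icc]
      simp only [ENNReal.coe_one, ENNReal.one_rpow, one_mul]
      congr 1; ring

theorem le_hausdorffMeasure_of_subset_proj {V : Type*} [NormedAddCommGroup V]
    [InnerProductSpace ℝ V] [MeasurableSpace V] [BorelSpace V] {T : V} (hT : ‖T‖ = 1)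
    (x : V) {r : ℝ} {A : Set V}
    (hA : Set.Icc (-r) r ⊆ (fun y => ⟪y - x, T⟫) '' A) :
    ENNReal.ofReal (2 * r) ≤ μH[1] A := by
  have hlip : LipschitzWith 1 (fun y : V => ⟪y - x, T⟫) := by
    refine LipschitzWith.of_dist_le_mul fun a b => ?_
    rw [Real.dist_eq, ← inner_sub_left, NNReal.coe_one, one_mul, dist_eq_norm]
    simpa [hT] using abs_real_inner_le_norm (a - x - (b - x)) T
  calc ENNReal.ofReal (2 * r) = μH[1] (Set.Icc (-r) r) := by
        rw [hausdorffMeasure_real, Real.volume_Icc]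
        congr 1; ring
    _ ≤ _ := measure_mono hA
    _ ≤ _ := (hlip.lipschitzOnWith (s := A)).hausdorffMeasure_image_le zero_le_one
    _ = _ := by simp

theorem exists_angle {a b : ℝ} (h : a ^ 2 + b ^ 2 = 1) :
    ∃ φ : ℝ, |φ| ≤ Real.pi ∧ a = Real.cos φ ∧ b = Real.sin φ := by
  have hn : ‖(⟨a, b⟩ : ℂ)‖ = 1 := by
    rw [← sq_eq_sq₀ (norm_nonneg _) zero_le_one, ← Complex.normSq_eq_norm_sq, Complex.normSq_mk]
    linarith
  refine ⟨Complex.arg ⟨a, b⟩, Complex.abs_arg_le_pi _, ?_, ?_⟩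
  · have := Complex.norm_mul_cos_arg ⟨a, b⟩
    rw [hn, one_mul] at this
    exact this.symm
  · have := Complex.norm_mul_sin_arg ⟨a, b⟩
    rw [hn, one_mul] at this
    exact this.symm

theorem exists_angle_lift {p q κ : ℝ → ℝ} (hκ : Continuous κ)
    (hp : ∀ s, HasDerivAt p (-(κ s * q s)) s) (hq : ∀ s, HasDerivAt q (κ s * p s) s)
    (hpq : ∀ s, p s ^ 2 + q s ^ 2 = 1) :
    ∃ θ : ℝ → ℝ, (∀ s, HasDerivAt θ (κ s) s) ∧
      ∀ s, p s = Real.cos (θ s) ∧ q s = Real.sin (θ s) := by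
  obtain ⟨θ₀, -, hp0, hq0⟩ := exists_angle (hpq 0)
  set θ : ℝ → ℝ := fun s => θ₀ + ∫ r in (0 : ℝ)..s, κ r with hθ
  have hθd : ∀ s, HasDerivAt θ (κ s) s := fun s =>
    (intervalIntegral.integral_hasDerivAt_right (hκ.intervalIntegrable _ _)
      hκ.aestronglyMeasurable.stronglyMeasurableAtFilter hκ.continuousAt).const_add _
  refine ⟨θ, hθd, fun s => ?_⟩
  set f : ℝ → ℝ := fun s => p s * Real.cos (θ s) + q s * Real.sin (θ s) with hf
  have hfd : ∀ s, HasDerivAt f 0 s := fun s =>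
    (((hp s).mul (hθd s).cos).add ((hq s).mul (hθd s).sin)).congr_deriv (by ring)
  have hc : f s = f 0 :=
    is_const_of_deriv_eq_zero (fun s => (hfd s).differentiableAt) (fun s => (hfd s).deriv) s 0
  have hθ0 : θ 0 = θ₀ := by simp [hθ]
  have h1 : p s * Real.cos (θ s) + q s * Real.sin (θ s) = 1 := by
    rw [show p s * Real.cos (θ s) + q s * Real.sin (θ s) = f s from rfl, hc, hf]
    simp only [hθ0, hp0, hq0]
    nlinarith [Real.sin_sq_add_cos_sq θ₀]
  have h2 : (p s - Real.cos (θ s)) ^ 2 + (q s - Real.sin (θ s)) ^ 2 = 0 := by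
    nlinarith [Real.sin_sq_add_cos_sq (θ s), hpq s]
  constructor
  · nlinarith [sq_nonneg (p s - Real.cos (θ s)), sq_nonneg (q s - Real.sin (θ s))]
  · nlinarith [sq_nonneg (p s - Real.cos (θ s)), sq_nonneg (q s - Real.sin (θ s))]

/-- Blaschke's rolling theorem: the intersection of the supporting half-planes of a curve with
curvature greater than one lies in a disc of radius less than one tangent at a given point. -/
theorem exists_rolling_disc {X Y p q κ : ℝ → ℝ} (hκ : Continuous κ) (hκ1 : ∀ s, 1 < κ s)
    (hX : ∀ s, HasDerivAt X (p s) s) (hY : ∀ s, HasDerivAt Y (q s) s)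
    (hp : ∀ s, HasDerivAt p (-(κ s * q s)) s) (hq : ∀ s, HasDerivAt q (κ s * p s) s)
    (hpq : ∀ s, p s ^ 2 + q s ^ 2 = 1) (s₀ : ℝ) :
    ∃ R : ℝ, 0 < R ∧ R < 1 ∧ ∀ a b : ℝ,
      (∀ s, (a - X s) * q s - (b - Y s) * p s ≤ 0) →
      (a - (X s₀ - R * q s₀)) ^ 2 + (b - (Y s₀ + R * p s₀)) ^ 2 ≤ R ^ 2 := by
  have hpi := Real.pi_pos
  obtain ⟨θ, hθ, hθpq⟩ := exists_angle_lift hκ hp hq hpq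
  obtain ⟨z, -, hz⟩ := (isCompact_Icc (a := s₀ - Real.pi) (b := s₀ + Real.pi)).exists_isMinOn
    ⟨s₀, by constructor <;> linarith⟩ hκ.continuousOn
  have hz1 := hκ1 z
  have hz0 : 0 < κ z := by linarith
  refine ⟨1 / κ z, by positivity, by rw [div_lt_one hz0]; exact hz1, fun a b hab => ?_⟩
  set R := 1 / κ z with hR
  have hR0 : 0 < R := by positivity
  have hRκ : ∀ s ∈ Set.Icc (s₀ - Real.pi) (s₀ + Real.pi), 0 ≤ R * κ s - 1 := fun s hs => by
    have h : κ z ≤ κ s := hz hs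
    have : R * κ z = 1 := by rw [hR]; field_simp
    nlinarith
  have hmono : Monotone (fun s => θ s - s) := by
    have h : ∀ s, HasDerivAt (fun s => θ s - s) (κ s - 1) s :=
      fun s => (hθ s).sub (hasDerivAt_id s)
    refine monotone_of_deriv_nonneg (fun s => (h s).differentiableAt) fun s => ?_
    rw [(h s).deriv]
    linarith [hκ1 s]
  have hθmono : Monotone θ := fun s r hsr => by
    have := hmono hsr
    simp only at this
    linarith
  have hθc : Continuous θ := continuous_iff_continuousAt.2 fun s => (hθ s).continuousAt
  -- comparison of the support functions
  have key : ∀ S ∈ Set.Icc (s₀ - Real.pi) (s₀ + Real.pi), |θ S - θ s₀| ≤ Real.pi →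
      (X S - R * q S) * q S - (Y S + R * p S) * p S ≤
        (X s₀ - R * q s₀) * q S - (Y s₀ + R * p s₀) * p S := by
    intro S hS hθS
    rw [abs_le] at hθS
    set Φ : ℝ → ℝ := fun s => (X s - R * q s) * q S - (Y s + R * p s) * p S with hΦ
    have hΦd : ∀ s, HasDerivAt Φ (-((R * κ s - 1) * Real.sin (θ S - θ s))) s := fun s => by
      refine ((((hX s).sub ((hq s).const_mul R)).mul_const (q S)).sub
        (((hY s).add ((hp s).const_mul R)).mul_const (p S))).congr_deriv ?_
      rw [Real.sin_sub, ← (hθpq s).1, ← (hθpq s).2, ← (hθpq S).1, ← (hθpq S).2]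
      ring
    have hΦc : Continuous Φ := continuous_iff_continuousAt.2 fun s => (hΦd s).continuousAt
    change Φ S ≤ Φ s₀
    rcases le_total s₀ S with h | h
    · refine antitoneOn_of_deriv_nonpos (convex_Icc s₀ S) hΦc.continuousOn
        (fun s _ => (hΦd s).differentiableAt.differentiableWithinAt) (fun s hs => ?_)
        (Set.left_mem_Icc.2 h) (Set.right_mem_Icc.2 h) h
      rw [interior_Icc] at hs
      rw [(hΦd s).deriv, neg_nonpos]
      refine mul_nonneg (hRκ s ⟨by linarith [hs.1], by linarith [hs.2, hS.2]⟩)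
        (Real.sin_nonneg_of_nonneg_of_le_pi ?_ ?_)
      · linarith [hθmono hs.2.le]
      · linarith [hθmono hs.1.le]
    · refine monotoneOn_of_deriv_nonneg (convex_Icc S s₀) hΦc.continuousOn
        (fun s _ => (hΦd s).differentiableAt.differentiableWithinAt) (fun s hs => ?_)
        (Set.left_mem_Icc.2 h) (Set.right_mem_Icc.2 h) h
      rw [interior_Icc] at hs
      rw [(hΦd s).deriv, neg_nonneg]
      refine mul_nonpos_of_nonneg_of_nonpos
        (hRκ s ⟨by linarith [hs.1, hS.1], by linarith [hs.2]⟩)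
        (Real.sin_nonpos_of_nonpos_of_neg_pi_le ?_ ?_)
      · linarith [hθmono hs.1.le]
      · linarith [hθmono hs.2.le]
  set d₀ := a - (X s₀ - R * q s₀) with hd₀
  set d₁ := b - (Y s₀ + R * p s₀) with hd₁
  set ρ := Real.sqrt (d₀ ^ 2 + d₁ ^ 2) with hρ
  have hρ2 : ρ ^ 2 = d₀ ^ 2 + d₁ ^ 2 := Real.sq_sqrt (by positivity)
  rw [← hρ2]
  rcases (Real.sqrt_nonneg (d₀ ^ 2 + d₁ ^ 2)).eq_or_lt with h0 | h0
  · rw [show ρ = 0 from h0.symm, zero_pow two_ne_zero]; positivity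
  rw [← hρ] at h0
  -- the angle of the direction of `(d₀, d₁)` relative to the normal at `s₀`
  obtain ⟨ψ, hψ, hc, hs⟩ : ∃ ψ : ℝ, |ψ| ≤ Real.pi ∧
      (d₀ * q s₀ - d₁ * p s₀) / ρ = Real.cos ψ ∧ (d₀ * p s₀ + d₁ * q s₀) / ρ = Real.sin ψ := by
    refine exists_angle ?_
    rw [div_pow, div_pow, ← add_div, div_eq_one_iff_eq (by positivity), hρ2]
    linear_combination (d₀ ^ 2 + d₁ ^ 2) * hpq s₀
  obtain ⟨hψ1, hψ2⟩ := abs_le.1 hψ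
  have hm1 := hmono (show s₀ ≤ s₀ + Real.pi by linarith)
  have hm2 := hmono (show s₀ - Real.pi ≤ s₀ by linarith)
  simp only at hm1 hm2
  obtain ⟨S, hS, hSψ⟩ := intermediate_value_Icc (show s₀ - Real.pi ≤ s₀ + Real.pi by linarith)
    hθc.continuousOn (show θ s₀ + ψ ∈ _ from ⟨by linarith, by linarith⟩)
  have hkey := key S hS (by rw [hSψ]; simpa using hψ)
  have hqS : q S * ρ = d₀ := by
    rw [(hθpq S).2, hSψ, Real.sin_add, ← hc, ← hs, ← (hθpq s₀).1, ← (hθpq s₀).2]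
    field_simp
    linear_combination d₀ * hpq s₀
  have hpS : p S * ρ = -d₁ := by
    rw [(hθpq S).1, hSψ, Real.cos_add, ← hc, ← hs, ← (hθpq s₀).1, ← (hθpq s₀).2]
    field_simp
    linear_combination -d₁ * hpq s₀
  have h3 : d₀ * q S - d₁ * p S ≤ R := by
    have := hab S
    have e : R * (p S ^ 2 + q S ^ 2) = R := by rw [hpq S, mul_one]
    rw [hd₀, hd₁]
    nlinarith
  have h4 : d₀ * q S - d₁ * p S = ρ := by
    have : ρ * (d₀ * q S - d₁ * p S) = ρ * ρ := by
      linear_combination d₀ * hqS - d₁ * hpS - hρ2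
    exact mul_left_cancel₀ h0.ne' this
  rw [h4] at h3
  exact pow_le_pow_left₀ h0.le h3 2

/-- Near `s₀`, a curve with curvature `κ` is a graph over its tangent line, lying between the
parabolas of curvatures `m₁ < κ s₀ < m₂`. -/
theorem eventually_graph_between_parabolas {X Y p q κ : ℝ → ℝ}
    (hX : ∀ s, HasDerivAt X (p s) s) (hY : ∀ s, HasDerivAt Y (q s) s)
    (hp : ∀ s, HasDerivAt p (-(κ s * q s)) s) (hq : ∀ s, HasDerivAt q (κ s * p s) s)
    (hpq : ∀ s, p s ^ 2 + q s ^ 2 = 1) (s₀ : ℝ) {m₁ m₂ : ℝ} (h₁ : m₁ < κ s₀) (h₂ : κ s₀ < m₂) :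
    ∀ᶠ a in 𝓝 (0 : ℝ), ∃ s, (X s - X s₀) * p s₀ + (Y s - Y s₀) * q s₀ = a ∧
      m₁ * a ^ 2 / 2 ≤ (Y s - Y s₀) * p s₀ - (X s - X s₀) * q s₀ ∧
      (Y s - Y s₀) * p s₀ - (X s - X s₀) * q s₀ ≤ m₂ * a ^ 2 / 2 ∧
      0 < p s * p s₀ + q s * q s₀ := by
  set α : ℝ → ℝ := fun s => (X s - X s₀) * p s₀ + (Y s - Y s₀) * q s₀ with hα
  set β : ℝ → ℝ := fun s => (Y s - Y s₀) * p s₀ - (X s - X s₀) * q s₀ with hβ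
  set α' : ℝ → ℝ := fun s => p s * p s₀ + q s * q s₀ with hα'
  set β' : ℝ → ℝ := fun s => q s * p s₀ - p s * q s₀ with hβ'
  have hαd : ∀ s, HasDerivAt α (α' s) s := fun s =>
    (((hX s).sub_const _).mul_const _).add (((hY s).sub_const _).mul_const _)
  have hβd : ∀ s, HasDerivAt β (β' s) s := fun s =>
    (((hY s).sub_const _).mul_const _).sub (((hX s).sub_const _).mul_const _)
  have hα'd : ∀ s, HasDerivAt α' (-(κ s * q s) * p s₀ + κ s * p s * q s₀) s := fun s =>
    ((hp s).mul_const _).add ((hq s).mul_const _)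
  have hβ'd : ∀ s, HasDerivAt β' (κ s * p s * p s₀ - -(κ s * q s) * q s₀) s := fun s =>
    ((hq s).mul_const _).sub ((hp s).mul_const _)
  have hα0 : α s₀ = 0 := by simp [hα]
  have hβ0 : β s₀ = 0 := by simp [hβ]
  have hα'0 : α' s₀ = 1 := by simp only [hα']; linear_combination hpq s₀
  have hβ'0 : β' s₀ = 0 := by simp only [hβ']; ring
  have hmin : ∀ m c : ℝ, 0 < c * (κ s₀ - m) →
      ∀ᶠ s in 𝓝 s₀, 0 ≤ c * (β s - m * α s ^ 2 / 2) := by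
    intro m c hc
    have hd : ∀ s, HasDerivAt (fun s => c * (β s - m * α s ^ 2 / 2))
        (c * (β' s - m * (α s * α' s))) s := fun s =>
      (((hβd s).sub ((((hαd s).pow 2).const_mul m).div_const 2)).const_mul c).congr_deriv
        (by ring)
    have hdd : HasDerivAt (fun s => c * (β' s - m * (α s * α' s))) (c * (κ s₀ - m)) s₀ := by
      refine (((hβ'd s₀).sub (((hαd s₀).mul (hα'd s₀)).const_mul m)).const_mul c).congr_deriv ?_
      rw [hα0, hα'0]
      linear_combination c * κ s₀ * hpq s₀
    have hde : deriv (fun s => c * (β s - m * α s ^ 2 / 2)) =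
        fun s => c * (β' s - m * (α s * α' s)) := funext fun s => (hd s).deriv
    have := isLocalMin_of_deriv_deriv_pos (f := fun s => c * (β s - m * α s ^ 2 / 2)) (x₀ := s₀)
      (by rw [hde, hdd.deriv]; exact hc) (by rw [hde]; simp [hα0, hβ'0])
      (hd s₀).continuousAt
    filter_upwards [this] with s hs
    simpa [hα0, hβ0] using hs
  have hev1 := hmin m₁ 1 (by linarith)
  have hev2 := hmin m₂ (-1) (by linarith)
  have hev3 : ∀ᶠ s in 𝓝 s₀, 0 < α' s :=
    (hα'd s₀).continuousAt.eventually (lt_mem_nhds (by rw [hα'0]; exact one_pos))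
  have hα'c : Continuous α' := continuous_iff_continuousAt.2 fun s => (hα'd s).continuousAt
  have hstrict : HasStrictDerivAt α (α' s₀) s₀ :=
    hasStrictDerivAt_of_hasDerivAt_of_continuousAt (Eventually.of_forall hαd) hα'c.continuousAt
  have hmap := hstrict.map_nhds_eq (by rw [hα'0]; exact one_ne_zero)
  rw [hα0] at hmap
  rw [← hmap, eventually_map]
  filter_upwards [hev1, hev2, hev3] with s h1 h2 h3
  exact ⟨s, rfl, by linarith, by linarith, h3⟩

section Frame

variable {V : Type*} [NormedAddCommGroup V] [InnerProductSpace ℝ V] [MeasurableSpace V]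
  [BorelSpace V] {K : Set V} {x T U : V}

theorem eventually_hausdorffMeasure_inter_sphere_le (hT : ‖T‖ = 1) (hU : ‖U‖ = 1)
    (hTU : ⟪T, U⟫ = 0) (hframe : ∀ y : V, y = ⟪y, T⟫ • T + ⟪y, U⟫ • U)
    {R : ℝ} (hR0 : 0 < R) (hR : R < 1) (hroll : ∀ y ∈ K, ‖y - (x - R • U)‖ ≤ R)
    {m m₁ : ℝ} (hm : 1 < m) (hm₁ : m < m₁)
    (hlow : ∀ᶠ a in 𝓝 (0 : ℝ), ∀ b : ℝ, x + a • T - b • U ∈ K → m₁ * a ^ 2 / 2 ≤ b) :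
    ∀ᶠ t in 𝓝[>] (0 : ℝ), μH[1] (K ∩ sphere (x - (1 + t) • U) 1) ≤
      ENNReal.ofReal (2 * √(2 * t / (m - 1))) := by
  have hpi := Real.pi_pos
  have hsinc : ∀ᶠ φ in 𝓝 (0 : ℝ), m < m₁ * Real.sinc φ ^ 2 :=
    (continuous_const.mul (Real.continuous_sinc.pow 2)).continuousAt.eventually
      (lt_mem_nhds (by simpa using hm₁))
  have hsin := (Real.continuous_sin.tendsto' 0 0 Real.sin_zero).eventually hlow
  obtain ⟨δ, hδ, hδφ⟩ := Metric.eventually_nhds_iff.1 (hsinc.and hsin)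
  have hη : 0 < (1 - R) * (2 / Real.pi ^ 2 * δ ^ 2) :=
    mul_pos (by linarith) (by positivity)
  filter_upwards [Ioo_mem_nhdsGT hη] with t ⟨ht0, htη⟩
  refine hausdorffMeasure_le_of_subset_arc hT hU hTU (x - (1 + t) • U) ?_
  rintro y ⟨hyK, hys⟩
  rw [mem_sphere, dist_eq_norm] at hys
  have hnorm : ∀ A B : ℝ, ‖A • T + B • U‖ ^ 2 = A ^ 2 + B ^ 2 := fun A B => by
    rw [norm_add_sq_real, inner_smul_left, inner_smul_right, hTU, norm_smul, norm_smul, hT, hU]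
    simp
  have hfr := hframe (y - (x - (1 + t) • U))
  obtain ⟨φ, hφπ, hcos, hsinφ⟩ := exists_angle
    (a := ⟪y - (x - (1 + t) • U), U⟫) (b := ⟪y - (x - (1 + t) • U), T⟫)
    (by rw [add_comm, ← hnorm, ← hfr, hys, one_pow])
  rw [hcos, hsinφ] at hfr
  have hy : y = x + Real.sin φ • T - (1 + t - Real.cos φ) • U := by
    rw [← sub_add_cancel y (x - (1 + t) • U), hfr]
    module
  have hcos2 := Real.cos_le_one_sub_mul_cos_sq hφπ
  have hcos1 := Real.one_sub_sq_div_two_le_cos (x := φ)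
  have hrolly : ‖y - (x - R • U)‖ ^ 2 ≤ R ^ 2 := pow_le_pow_left₀ (norm_nonneg _) (hroll y hyK) 2
  have hyR : y - (x - R • U) = Real.sin φ • T + (R - (1 + t - Real.cos φ)) • U := by
    rw [hy]; module
  rw [hyR, hnorm] at hrolly
  have hw : (1 - R) * (1 - Real.cos φ) ≤ t := by
    nlinarith [Real.sin_sq_add_cos_sq φ, Real.cos_le_one φ]
  have hφδ : |φ| < δ := by
    by_contra! h
    have h1 : δ ^ 2 ≤ φ ^ 2 := by rw [← sq_abs φ]; exact pow_le_pow_left₀ hδ.le h 2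
    have h2 : 2 / Real.pi ^ 2 * δ ^ 2 ≤ 2 / Real.pi ^ 2 * φ ^ 2 := by gcongr
    nlinarith
  obtain ⟨hs1, hs2⟩ := hδφ (show dist φ 0 < δ by simpa using hφδ)
  have hb := hs2 (1 + t - Real.cos φ) (hy ▸ hyK)
  have hsq : φ ^ 2 ≤ 2 * t / (m - 1) := by
    rw [le_div_iff₀ (by linarith)]
    have h1 : Real.sin φ = φ * Real.sinc φ := by
      rcases eq_or_ne φ 0 with rfl | h
      · simp
      · rw [Real.sinc_of_ne_zero h]; field_simp
    rw [h1] at hb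
    nlinarith [mul_le_mul_of_nonneg_left hs1.le (sq_nonneg φ)]
  refine ⟨φ, abs_le.1 (Real.abs_le_sqrt hsq), ?_⟩
  simp only
  rw [hy]
  module

theorem eventually_le_hausdorffMeasure_inter_sphere (hT : ‖T‖ = 1) (hU : ‖U‖ = 1)
    (hTU : ⟪T, U⟫ = 0) {m : ℝ} (hm : 1 < m)
    {δ : ℝ} (hδ : 0 < δ) (hup : ∀ a b : ℝ, |a| < δ → m * a ^ 2 / 2 ≤ b → b < δ →
      x + a • T - b • U ∈ K) :
    ∀ᶠ t in 𝓝[>] (0 : ℝ), ENNReal.ofReal (2 * √(2 * t / (m - 1))) ≤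
      μH[1] (K ∩ sphere (x - (1 + t) • U) 1) := by
  have hlim : Tendsto (fun t : ℝ => 2 * t / (m - 1)) (𝓝[>] 0) (𝓝 0) :=
    ((by fun_prop : Continuous fun t : ℝ => 2 * t / (m - 1)).tendsto' 0 0
      (by simp)).mono_left nhdsWithin_le_nhds
  have hlim2 : Tendsto (fun t : ℝ => t + 2 * t / (m - 1)) (𝓝[>] 0) (𝓝 0) :=
    ((by fun_prop : Continuous fun t : ℝ => t + 2 * t / (m - 1)).tendsto' 0 0
      (by simp)).mono_left nhdsWithin_le_nhds
  filter_upwards [self_mem_nhdsWithin, hlim.eventually (gt_mem_nhds (sq_pos_of_pos hδ)),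
    hlim.eventually (gt_mem_nhds one_pos), hlim2.eventually (gt_mem_nhds hδ)]
    with t (ht0 : 0 < t) ht1 ht2 ht3
  refine le_hausdorffMeasure_of_subset_proj hT x ?_
  intro a ha
  have hr0 : 0 ≤ 2 * t / (m - 1) := div_nonneg (by linarith) (by linarith)
  have ha2 : a ^ 2 ≤ 2 * t / (m - 1) := by
    rw [← Real.sq_sqrt hr0]
    exact sq_le_sq' ha.1 ha.2
  have hrm : a ^ 2 * (m - 1) ≤ 2 * t := (le_div_iff₀ (by linarith)).1 ha2
  have hc0 : 0 ≤ 1 - a ^ 2 := by linarith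
  set c := √(1 - a ^ 2) with hc
  have hc2 : c ^ 2 = 1 - a ^ 2 := Real.sq_sqrt hc0
  have hcn : 0 ≤ c := Real.sqrt_nonneg _
  have hc1 : c ≤ 1 - a ^ 2 / 2 := by
    nlinarith [sq_nonneg (a ^ 2)]
  have hc3 : 1 - a ^ 2 ≤ c := by nlinarith
  refine ⟨x + a • T - (1 + t - c) • U, ⟨hup a _ ?_ ?_ ?_, ?_⟩, ?_⟩
  · exact abs_lt_of_sq_lt_sq (ha2.trans_lt ht1) hδ.le
  · linarith
  · linarith
  · have h1 : x + a • T - (1 + t - c) • U - (x - (1 + t) • U) = a • T + c • U := by module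
    rw [mem_sphere, dist_eq_norm, h1, ← sq_eq_sq₀ (norm_nonneg _) zero_le_one, norm_add_sq_real,
      inner_smul_left, inner_smul_right, hTU, norm_smul, norm_smul, hT, hU]
    simp [hc2]
  · have h1 : x + a • T - (1 + t - c) • U - x = a • T - (1 + t - c) • U := by module
    have hUT : ⟪U, T⟫ = 0 := by rw [real_inner_comm]; exact hTU
    simp only
    rw [h1, inner_sub_left, inner_smul_left, inner_smul_left, hUT, real_inner_self_eq_norm_sq, hT]
    simp

end Frame

/-- If `U` is the only unit outer normal at `x`, then the inner normal ray at `x` meets the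
interior. -/
theorem exists_sub_smul_mem_interior {V : Type*} [NormedAddCommGroup V] [InnerProductSpace ℝ V]
    [CompleteSpace V] {K : Set V} (hK : IsClosed K) (hconv : Convex ℝ K)
    (hKi : (interior K).Nonempty) {x U : V} (hx : x ∈ frontier K) (hU : ‖U‖ = 1)
    (huniq : ∀ v, ‖v‖ = 1 → (∀ y ∈ K, ⟪y - x, v⟫ ≤ 0) → v = U) :
    ∃ δ : ℝ, 0 < δ ∧ x - δ • U ∈ interior K := by
  by_contra! h
  have hdisj : Disjoint (interior K) ((fun r : ℝ => x - r • U) '' Set.Ici 0) := by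
    rw [Set.disjoint_right]
    rintro _ ⟨r, hr, rfl⟩
    rcases (show (0 : ℝ) ≤ r from hr).eq_or_lt with rfl | hr
    · simpa using hx.2
    · exact h r hr
  have hcr : Convex ℝ ((fun r : ℝ => x - r • U) '' Set.Ici 0) := by
    have h1 : (fun r : ℝ => x - r • U) = AffineMap.lineMap x (x - U) := by
      ext r
      rw [AffineMap.lineMap_apply, vsub_eq_sub, vadd_eq_add]
      module
    rw [h1]
    exact (convex_Ici (0 : ℝ)).affine_image _
  obtain ⟨f, c, hf1, hf2⟩ := geometric_hahn_banach_open hconv.interior isOpen_interior hcr hdisj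
  have hfK : ∀ y ∈ K, f y ≤ c := by
    intro y hy
    have hy' : y ∈ closure (interior K) := by
      rw [hconv.closure_interior_eq_closure_of_nonempty_interior hKi]
      exact subset_closure hy
    exact closure_minimal (fun z hz => (hf1 z hz).le)
      (isClosed_le f.continuous continuous_const) hy'
  have hfx : c ≤ f x := by simpa using hf2 x ⟨0, Set.self_mem_Ici, by simp⟩
  have hfU : f U ≤ 0 := by
    have h1 := hf2 (x - (1 : ℝ) • U) ⟨1, Set.mem_Ici.2 zero_le_one, rfl⟩
    have h2 := hfK x (hK.frontier_subset hx)
    rw [one_smul, map_sub] at h1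
    linarith
  set w := (InnerProductSpace.toDual ℝ V).symm f with hw
  have hfw : ∀ y, f y = ⟪y, w⟫ := fun y => by
    rw [real_inner_comm, hw, InnerProductSpace.toDual_symm_apply]
  have hw0 : w ≠ 0 := by
    intro h0
    obtain ⟨z, hz⟩ := hKi
    have := hf1 z hz
    rw [hfw] at this hfx
    simp only [h0, inner_zero_right] at this hfx
    linarith
  have hwn : 0 < ‖w‖ := norm_pos_iff.2 hw0
  have hv := huniq (‖w‖⁻¹ • w) (by rw [norm_smul, norm_inv, norm_norm, inv_mul_cancel₀ hwn.ne'])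
    fun y hy => by
      rw [inner_smul_right, ← hfw, map_sub]
      exact mul_nonpos_of_nonneg_of_nonpos (by positivity) (by linarith [hfK y hy])
  have h1 : ⟪U, ‖w‖⁻¹ • w⟫ = 1 := by rw [hv, real_inner_self_eq_norm_sq, hU, one_pow]
  rw [inner_smul_right, ← hfw] at h1
  have h2 := mul_nonpos_of_nonneg_of_nonpos (inv_nonneg.2 hwn.le) hfU
  linarith

/-- For a planar convex body `K` with `C²` boundary and curvature `κ > 1` everywhere,
the arc length `ℓ(u_x, t)` of the circular part of the boundary of the disc-cap of
height `t` with vertex `x = γ s` satisfies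
`lim_{t→0⁺} ℓ(u_x,t) · t^{-1/2} = 2·√(2/(κ(x)-1))`.
Arc length is measured by the one-dimensional Hausdorff measure. -/
theorem disc_cap_arclength_limit
    (K : Set (EuclideanSpace ℝ (Fin 2)))
    (hKcomp : IsCompact K) (hKconv : Convex ℝ K) (hKint : (interior K).Nonempty)
    (γ : ℝ → EuclideanSpace ℝ (Fin 2)) (hγ : ContDiff ℝ 2 γ)
    (hγspeed : ∀ s, ‖deriv γ s‖ = 1)
    (hγrange : frontier K = Set.range γ)
    (κ : ℝ → ℝ)
    (hκdef : ∀ s, κ s =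
      deriv γ s 0 * deriv (deriv γ) s 1 - deriv γ s 1 * deriv (deriv γ) s 0)
    (hκ : ∀ s, 1 < κ s)
    (u : EuclideanSpace ℝ (Fin 2) → EuclideanSpace ℝ (Fin 2))
    (hu : ∀ x ∈ frontier K, ‖u x‖ = 1 ∧ ∀ y ∈ K, ⟪y - x, u x⟫ ≤ 0)
    (huniq : ∀ x ∈ frontier K, ∀ v, ‖v‖ = 1 → (∀ y ∈ K, ⟪y - x, v⟫ ≤ 0) → v = u x)
    (s : ℝ) :
    Tendsto
      (fun t : ℝ =>
        (μH[1] (frontier (K \ ball (γ s - (1 + t) • u (γ s)) 1) ∩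
            sphere (γ s - (1 + t) • u (γ s)) 1)).toReal / Real.sqrt t)
      (𝓝[>] 0) (𝓝 (2 * Real.sqrt (2 / (κ s - 1)))) := by
  set p : ℝ → ℝ := fun r => deriv γ r 0
  set q : ℝ → ℝ := fun r => deriv γ r 1
  have hin : ∀ y z : EuclideanSpace ℝ (Fin 2), ⟪y, z⟫ = y 0 * z 0 + y 1 * z 1 := fun y z => by
    rw [PiLp.inner_apply, Fin.sum_univ_two]
    simp [mul_comm]
  have hnsq : ∀ y : EuclideanSpace ℝ (Fin 2), ‖y‖ ^ 2 = y 0 ^ 2 + y 1 ^ 2 := fun y => by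
    rw [← real_inner_self_eq_norm_sq, hin]; ring
  have hcoord : ∀ {f : ℝ → EuclideanSpace ℝ (Fin 2)} {r : ℝ}, DifferentiableAt ℝ f r →
      ∀ i, HasDerivAt (fun r => f r i) (deriv f r i) r := fun hf i =>
    (EuclideanSpace.proj (𝕜 := ℝ) i).hasFDerivAt.comp_hasDerivAt _ hf.hasDerivAt
  have hγ' : ContDiff ℝ 1 (deriv γ) :=
    ((contDiff_succ_iff_deriv (n := 1)).1 (by simpa [one_add_one_eq_two] using hγ)).2.2
  have hX : ∀ r, HasDerivAt (fun r => γ r 0) (p r) r := fun r =>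
    hcoord (hγ.differentiable (by norm_num)).differentiableAt 0
  have hY : ∀ r, HasDerivAt (fun r => γ r 1) (q r) r := fun r =>
    hcoord (hγ.differentiable (by norm_num)).differentiableAt 1
  have hpd : ∀ r, HasDerivAt p (deriv (deriv γ) r 0) r := fun r =>
    hcoord (hγ'.differentiable (by norm_num)).differentiableAt 0
  have hqd : ∀ r, HasDerivAt q (deriv (deriv γ) r 1) r := fun r =>
    hcoord (hγ'.differentiable (by norm_num)).differentiableAt 1
  have hpq : ∀ r, p r ^ 2 + q r ^ 2 = 1 := fun r => by
    rw [← hnsq, hγspeed, one_pow]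
  have horth : ∀ r, p r * deriv (deriv γ) r 0 + q r * deriv (deriv γ) r 1 = 0 := fun r => by
    have h1 := ((hpd r).pow 2).add ((hqd r).pow 2)
    have h2 : p ^ 2 + q ^ 2 = fun _ => (1 : ℝ) := funext hpq
    rw [h2] at h1
    have h3 := h1.unique (hasDerivAt_const r (1 : ℝ))
    norm_num at h3
    linarith
  have hpκ : ∀ r, HasDerivAt p (-(κ r * q r)) r := fun r => (hpd r).congr_deriv (by
    rw [hκdef]
    linear_combination -deriv (deriv γ) r 0 * hpq r + p r * horth r)
  have hqκ : ∀ r, HasDerivAt q (κ r * p r) r := fun r => (hqd r).congr_deriv (by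
    rw [hκdef]
    linear_combination -deriv (deriv γ) r 1 * hpq r + q r * horth r)
  have hpc : Continuous p := continuous_iff_continuousAt.2 fun r => (hpd r).continuousAt
  have hqc : Continuous q := continuous_iff_continuousAt.2 fun r => (hqd r).continuousAt
  have hκc : Continuous κ := by
    have h1 : Continuous (deriv (deriv γ)) := hγ'.continuous_deriv le_rfl
    have h2 : ∀ i, Continuous fun r => deriv (deriv γ) r i := fun i =>
      (EuclideanSpace.proj (𝕜 := ℝ) i).continuous.comp h1
    rw [show κ = _ from funext hκdef]
    exact (hpc.mul (h2 1)).sub (hqc.mul (h2 0))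
  have hfr : ∀ r, γ r ∈ frontier K := fun r => hγrange ▸ Set.mem_range_self r
  have hγK : ∀ r, γ r ∈ K := fun r => hKcomp.isClosed.frontier_subset (hfr r)
  have hgraph := fun r m₁ m₂ => eventually_graph_between_parabolas (m₁ := m₁) (m₂ := m₂)
    hX hY hpκ hqκ hpq r
  have hnormal : ∀ r, u (γ r) 0 = q r ∧ u (γ r) 1 = -p r := by
    intro r
    obtain ⟨hn, hsup⟩ := hu (γ r) (hfr r)
    have hn2 : u (γ r) 0 ^ 2 + u (γ r) 1 ^ 2 = 1 := by rw [← hnsq, hn, one_pow]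
    have hs : ∀ v, (γ v 0 - γ r 0) * u (γ r) 0 + (γ v 1 - γ r 1) * u (γ r) 1 ≤ 0 := fun v => by
      simpa [hin] using hsup (γ v) (hγK v)
    have hmax : IsLocalMax
        (fun v => (γ v 0 - γ r 0) * u (γ r) 0 + (γ v 1 - γ r 1) * u (γ r) 1) r :=
      Eventually.of_forall fun v => by simpa using hs v
    have hort := hmax.hasDerivAt_eq_zero
      ((((hX r).sub_const (γ r 0)).mul_const (u (γ r) 0)).add
        (((hY r).sub_const (γ r 1)).mul_const (u (γ r) 1)))
    set c := q r * u (γ r) 0 - p r * u (γ r) 1 with hc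
    have hu0 : u (γ r) 0 = c * q r := by
      rw [hc]; linear_combination -u (γ r) 0 * hpq r + p r * hort
    have hu1 : u (γ r) 1 = -c * p r := by
      rw [hc]; linear_combination -u (γ r) 1 * hpq r + q r * hort
    have hc2 : c ^ 2 = 1 := by
      rw [hu0, hu1] at hn2
      linear_combination hn2 - c ^ 2 * hpq r
    rcases sq_eq_one_iff.1 hc2 with h | h
    · rw [hu0, hu1, h]; constructor <;> ring
    · exfalso
      obtain ⟨ε, hε, hεa⟩ := Metric.eventually_nhds_iff.1 (hgraph r 1 (κ r + 1) (hκ r) (by simp))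
      obtain ⟨v, -, h1, -, -⟩ := hεa (y := ε / 2) (by
        rw [Real.dist_eq, sub_zero, abs_of_pos (by positivity)]; linarith)
      have h2 := hs v
      rw [hu0, hu1, h] at h2
      have : 0 < ε ^ 2 := by positivity
      nlinarith
  have hsupp : ∀ y ∈ K, ∀ r, (y 0 - γ r 0) * q r - (y 1 - γ r 1) * p r ≤ 0 := fun y hy r => by
    have h1 := (hu (γ r) (hfr r)).2 y hy
    rw [hin, (hnormal r).1, (hnormal r).2] at h1
    simp only [PiLp.sub_apply] at h1
    linarith
  set x := γ s
  set T := deriv γ s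
  set U := u x
  have hT0 : T 0 = p s := rfl
  have hT1 : T 1 = q s := rfl
  obtain ⟨hU0, hU1⟩ : U 0 = q s ∧ U 1 = -p s := hnormal s
  have hT : ‖T‖ = 1 := hγspeed s
  have hU : ‖U‖ = 1 := (hu x (hfr s)).1
  have hTU : ⟪T, U⟫ = 0 := by rw [hin, hT0, hT1, hU0, hU1]; ring
  have hext : ∀ {y z : EuclideanSpace ℝ (Fin 2)}, y 0 = z 0 → y 1 = z 1 → y = z := by
    intro y z h0 h1
    ext i
    fin_cases i
    · exact h0
    · exact h1
  have hframe : ∀ y, y = ⟪y, T⟫ • T + ⟪y, U⟫ • U := fun y => by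
    apply hext
    · simp only [PiLp.add_apply, PiLp.smul_apply, smul_eq_mul, hin, hT0, hT1, hU0, hU1]
      linear_combination -y 0 * hpq s
    · simp only [PiLp.add_apply, PiLp.smul_apply, smul_eq_mul, hin, hT0, hT1, hU0, hU1]
      linear_combination -y 1 * hpq s
  obtain ⟨R, hR0, hR1, hR⟩ := exists_rolling_disc hκc hκ hX hY hpκ hqκ hpq s
  have hroll : ∀ y ∈ K, ‖y - (x - R • U)‖ ≤ R := fun y hy => by
    rw [← sq_le_sq₀ (norm_nonneg _) hR0.le, hnsq]
    simp only [PiLp.sub_apply, PiLp.smul_apply, smul_eq_mul, hU0, hU1]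
    linarith [hR (y 0) (y 1) (hsupp y hy)]
  have hlow : ∀ m₁ < κ s, ∀ᶠ a in 𝓝 (0 : ℝ), ∀ b : ℝ, x + a • T - b • U ∈ K →
      m₁ * a ^ 2 / 2 ≤ b := by
    intro m₁ hm₁
    filter_upwards [hgraph s m₁ (κ s + 1) hm₁ (by simp)] with a ⟨r, hra, hr1, _, hr3⟩ b hb
    have h1 := hsupp _ hb r
    simp only [PiLp.sub_apply, PiLp.add_apply, PiLp.smul_apply, smul_eq_mul, hT0, hT1, hU0, hU1]
      at h1
    set β := (γ r 1 - γ s 1) * p s - (γ r 0 - γ s 0) * q s with hβ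
    have h2 : (β - b) * (p r * p s + q r * q s) ≤ 0 := by
      have e0 : γ r 0 = x 0 + a * p s - β * q s := by
        rw [← hra, hβ]; linear_combination -(γ r 0 - γ s 0) * hpq s
      have e1 : γ r 1 = x 1 + a * q s + β * p s := by
        rw [← hra, hβ]; linear_combination -(γ r 1 - γ s 1) * hpq s
      rw [e0, e1] at h1
      linarith
    have h3 : β - b ≤ 0 := by
      by_contra! h
      exact absurd h2 (mul_pos h hr3).not_ge
    linarith
  have hup : ∀ m₂ > κ s, ∃ δ > 0, ∀ a b : ℝ, |a| < δ → m₂ * a ^ 2 / 2 ≤ b → b < δ →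
      x + a • T - b • U ∈ K := by
    intro m₂ hm₂
    obtain ⟨δ₁, hδ₁, hKi⟩ := exists_sub_smul_mem_interior hKcomp.isClosed hKconv hKint (hfr s) hU
      (huniq x (hfr s))
    obtain ⟨ε₁, hε₁, hball⟩ := Metric.isOpen_iff.1 isOpen_interior _ hKi
    obtain ⟨ε₂, hε₂, hev⟩ := Metric.eventually_nhds_iff.1 (hgraph s 1 m₂ (hκ s) hm₂)
    refine ⟨min δ₁ (min ε₁ ε₂), by positivity, fun a b ha hab hb => ?_⟩
    simp only [lt_min_iff] at ha hb
    obtain ⟨r, hra, -, hr2, -⟩ := hev (y := a) (by rw [Real.dist_eq, sub_zero]; exact ha.2.2)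
    set β := (γ r 1 - γ s 1) * p s - (γ r 0 - γ s 0) * q s with hβ
    have hγr : γ r = x + a • T - β • U := by
      apply hext
      · simp only [PiLp.sub_apply, PiLp.add_apply, PiLp.smul_apply, smul_eq_mul, hT0, hU0]
        rw [← hra, hβ]; linear_combination -(γ r 0 - γ s 0) * hpq s
      · simp only [PiLp.sub_apply, PiLp.add_apply, PiLp.smul_apply, smul_eq_mul, hT1, hU1]
        rw [← hra, hβ]; linear_combination -(γ r 1 - γ s 1) * hpq s
    have htop : x + a • T - δ₁ • U ∈ K := by
      refine interior_subset (hball ?_)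
      have h1 : x + a • T - δ₁ • U - (x - δ₁ • U) = a • T := by module
      rw [mem_ball, dist_eq_norm, h1, norm_smul, hT, mul_one]
      exact ha.2.1
    have hβδ : 0 < δ₁ - β := by linarith
    have := hKconv (hγK r) htop (a := (δ₁ - b) / (δ₁ - β)) (b := (b - β) / (δ₁ - β))
      (div_nonneg (by linarith) hβδ.le) (div_nonneg (by linarith) hβδ.le)
      (by field_simp; ring)
    convert this using 1
    have hb1 : (δ₁ - b) / (δ₁ - β) = 1 - (b - β) / (δ₁ - β) := by field_simp; ring
    have hb2 : b = β + (b - β) / (δ₁ - β) * (δ₁ - β) := by field_simp; ring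
    rw [hγr, hb1]
    nth_rewrite 1 [hb2]
    module
  simp only [frontier_diff_ball_inter_sphere hKcomp.isClosed _ one_ne_zero]
  have hF : ContinuousAt (fun m : ℝ => 2 * √(2 / (m - 1))) (κ s) := by
    have : κ s - 1 ≠ 0 := by linarith [hκ s]
    fun_prop (disch := assumption)
  have hsqrt : ∀ m t : ℝ, 0 < t → 2 * √(2 * t / (m - 1)) = 2 * √(2 / (m - 1)) * √t := by
    intro m t ht
    rw [mul_div_right_comm, Real.sqrt_mul' _ ht.le, mul_assoc]
  have hle : ∀ m, 1 < m → m < κ s → ∀ᶠ t in 𝓝[>] (0 : ℝ),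
      μH[1] (K ∩ sphere (x - (1 + t) • U) 1) ≤ ENNReal.ofReal (2 * √(2 * t / (m - 1))) := by
    intro m hm hmκ
    obtain ⟨m₁, hmm₁, hm₁κ⟩ := exists_between hmκ
    exact eventually_hausdorffMeasure_inter_sphere_le hT hU hTU hframe hR0 hR1 hroll hm hmm₁
      (hlow m₁ hm₁κ)
  refine tendsto_order.2 ⟨fun l hl => ?_, fun l hl => ?_⟩
  · obtain ⟨m, hml, hm⟩ := (((hF.eventually (lt_mem_nhds hl)).filter_mono nhdsWithin_le_nhds).and
      (self_mem_nhdsWithin (a := κ s) (s := Set.Ioi (κ s)))).exists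
    obtain ⟨δ, hδ, hδK⟩ := hup m hm
    obtain ⟨m', hm', hm'κ⟩ := exists_between (hκ s)
    filter_upwards [self_mem_nhdsWithin, hle m' hm' hm'κ,
      eventually_le_hausdorffMeasure_inter_sphere hT hU hTU ((hκ s).trans hm) hδ hδK]
      with t (ht : 0 < t) h1 h2
    have h3 := (ENNReal.ofReal_le_iff_le_toReal (h1.trans_lt ENNReal.ofReal_lt_top).ne).1 h2
    rw [lt_div_iff₀ (Real.sqrt_pos.2 ht)]
    rw [hsqrt _ _ ht] at h3
    exact (mul_lt_mul_of_pos_right hml (Real.sqrt_pos.2 ht)).trans_le h3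
  · obtain ⟨m, ⟨hml, hm1⟩, hm⟩ := ((((hF.eventually (gt_mem_nhds hl)).and
      (lt_mem_nhds (hκ s))).filter_mono nhdsWithin_le_nhds).and
      (self_mem_nhdsWithin (a := κ s) (s := Set.Iio (κ s)))).exists
    filter_upwards [self_mem_nhdsWithin, hle m hm1 hm] with t (ht : 0 < t) h1
    have h3 := ENNReal.toReal_le_of_le_ofReal (by positivity) h1
    rw [div_lt_iff₀ (Real.sqrt_pos.2 ht)]
    rw [hsqrt _ _ ht] at h3
    exact h3.trans_lt (mul_lt_mul_of_pos_right hml (Real.sqrt_pos.2 ht))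
end

section
/- Let K be a planar convex body with C² boundary and minimal curvature κ_m > 1. For each boundary point x of K, the area A(u_x,t) of the disc-cap of height t with vertex x satisfies lim_{t→0⁺} A(u_x,t)·t^{−3/2} = (4/3)·√(2/(κ(x)−1)). -/
open Metric Filter MeasureTheory
open scoped RealInnerProductSpace Topology

/-- The area between the parabolas `y = k x² / 2` and `y = t + m x² / 2`. -/
theorem volume_between_parabolas {k m t : ℝ} (hkm : m < k) (ht : 0 < t) :
    volume {p : ℝ × ℝ | k / 2 * p.1 ^ 2 ≤ p.2 ∧ p.2 ≤ t + m / 2 * p.1 ^ 2} =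
      ENNReal.ofReal (4 / 3 * √(2 / (k - m)) * t ^ ((3 : ℝ) / 2)) := by
  have hd : 0 < k - m := sub_pos.2 hkm
  have hmeas : MeasurableSet {p : ℝ × ℝ | k / 2 * p.1 ^ 2 ≤ p.2 ∧ p.2 ≤ t + m / 2 * p.1 ^ 2} :=
    measurableSet_setOfPred.2 <|
      (measurableSet_setOfPred.1 (measurableSet_le (by fun_prop) (by fun_prop))).and
        (measurableSet_setOfPred.1 (measurableSet_le (by fun_prop) (by fun_prop)))
  set w : ℝ := √(2 / (k - m)) * √t with hw
  have hw0 : 0 ≤ w := by positivity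
  have hw2 : (k - m) * w ^ 2 = 2 * t := by
    rw [hw, mul_pow, Real.sq_sqrt (by positivity), Real.sq_sqrt ht.le]
    field_simp
  have hsec (a : ℝ) : volume (Prod.mk a ⁻¹'
      {p : ℝ × ℝ | k / 2 * p.1 ^ 2 ≤ p.2 ∧ p.2 ≤ t + m / 2 * p.1 ^ 2}) =
      (Set.Icc (-w) w).indicator (fun a ↦ ENNReal.ofReal (t - (k - m) / 2 * a ^ 2)) a := by
    have : Prod.mk a ⁻¹' {p : ℝ × ℝ | k / 2 * p.1 ^ 2 ≤ p.2 ∧ p.2 ≤ t + m / 2 * p.1 ^ 2} =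
        Set.Icc (k / 2 * a ^ 2) (t + m / 2 * a ^ 2) := rfl
    rw [this, Real.volume_Icc]
    by_cases ha : a ∈ Set.Icc (-w) w
    · rw [Set.indicator_of_mem ha]
      congr 1
      ring
    · rw [Set.indicator_of_notMem ha, ENNReal.ofReal_eq_zero]
      have : w < |a| := by
        rw [Set.mem_Icc, ← abs_le] at ha
        exact not_le.1 ha
      have : w ^ 2 < a ^ 2 := by
        rw [← sq_abs a]
        gcongr
      nlinarith
  rw [Measure.volume_eq_prod, Measure.prod_apply hmeas, lintegral_congr hsec,
    lintegral_indicator measurableSet_Icc, ← ofReal_integral_eq_lintegral_ofReal]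
  · congr 1
    rw [integral_Icc_eq_integral_Ioc, ← intervalIntegral.integral_of_le (by linarith)]
    rw [intervalIntegral.integral_sub (by simp) (Continuous.intervalIntegrable (by fun_prop) _ _),
      intervalIntegral.integral_const, intervalIntegral.integral_const_mul, integral_pow]
    have h32 : t ^ ((3 : ℝ) / 2) = t * √t := by
      rw [Real.sqrt_eq_rpow, ← Real.rpow_one_add' ht.le (by norm_num)]
      norm_num
    rw [h32, smul_eq_mul]
    have : 4 / 3 * √(2 / (k - m)) * (t * √t) = 4 / 3 * t * w := by rw [hw]; ring
    rw [this]
    push_cast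
    linear_combination (-w / 3) * hw2
  · exact (Continuous.integrableOn_Icc (by fun_prop))
  · filter_upwards [ae_restrict_mem measurableSet_Icc] with a ha
    have : a ^ 2 ≤ w ^ 2 := sq_le_sq' ha.1 ha.2
    simp only [Pi.zero_apply]
    nlinarith

/-- A planar convex set with boundary arc `(X, Y)`, parametrized by arc length, with tangent angle
`θ` and curvature `κ`, normalized so that at parameter `s` the arc passes through the origin in
direction `(1, 0)`. -/
structure IsBoundaryArc (S : Set (ℝ × ℝ)) (X Y θ κ : ℝ → ℝ) (s : ℝ) : Prop where
  convex : Convex ℝ S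
  continuous_curvature : Continuous κ
  one_lt_curvature : ∀ r, 1 < κ r
  hasDerivAt_angle : ∀ r, HasDerivAt θ (κ r) r
  hasDerivAt_fst : ∀ r, HasDerivAt X (Real.cos (θ r)) r
  hasDerivAt_snd : ∀ r, HasDerivAt Y (Real.sin (θ r)) r
  fst_eq_zero : X s = 0
  snd_eq_zero : Y s = 0
  angle_eq_zero : θ s = 0
  mem : ∀ r, (X r, Y r) ∈ S
  support : ∀ r, ∀ p ∈ S, (p.1 - X r) * Real.sin (θ r) ≤ (p.2 - Y r) * Real.cos (θ r)

namespace IsBoundaryArc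

variable {S : Set (ℝ × ℝ)} {X Y θ κ : ℝ → ℝ} {s : ℝ}

theorem strictMono_angle (h : IsBoundaryArc S X Y θ κ s) : StrictMono θ :=
  strictMono_of_deriv_pos fun r ↦ by
    rw [(h.hasDerivAt_angle r).deriv]
    linarith [h.one_lt_curvature r]

theorem continuous_angle (h : IsBoundaryArc S X Y θ κ s) : Continuous θ :=
  continuous_iff_continuousAt.2 fun r ↦ (h.hasDerivAt_angle r).continuousAt

theorem continuous_fst (h : IsBoundaryArc S X Y θ κ s) : Continuous X :=
  continuous_iff_continuousAt.2 fun r ↦ (h.hasDerivAt_fst r).continuousAt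

theorem surjective_angle (h : IsBoundaryArc S X Y θ κ s) : Function.Surjective θ := by
  have hmono : Monotone fun r ↦ θ r - r := by
    refine monotone_of_deriv_nonneg
      (fun r ↦ ((h.hasDerivAt_angle r).sub (hasDerivAt_id r)).differentiableAt) fun r ↦ ?_
    have := ((h.hasDerivAt_angle r).sub (hasDerivAt_id r)).deriv
    simp only [Pi.sub_def, id] at this
    rw [this]
    linarith [h.one_lt_curvature r]
  refine h.continuous_angle.surjective ?_ ?_
  · refine tendsto_atTop_mono' _ ?_ (tendsto_atTop_add_const_right _ (θ 0) tendsto_id)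
    filter_upwards [eventually_ge_atTop 0] with r hr
    have := hmono hr
    simp only [id] at this ⊢
    linarith
  · refine tendsto_atBot_mono' _ ?_ (tendsto_atBot_add_const_right _ (θ 0) tendsto_id)
    filter_upwards [eventually_le_atBot 0] with r hr
    have := hmono hr
    simp only [id] at this ⊢
    linarith

/-- Comparison of the support function of the arc with that of the unit disc touching it
from inside at the origin. -/
theorem support_lt (h : IsBoundaryArc S X Y θ κ s) {r : ℝ} (hrs : r ≠ s)
    (hr : θ r ∈ Set.Icc (-Real.pi) Real.pi) :
    X r * Real.sin (θ r) - Y r * Real.cos (θ r) < 1 - Real.cos (θ r) := by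
  set G : ℝ → ℝ := fun q ↦ (X r - X q) * Real.sin (θ r) - (Y r - Y q) * Real.cos (θ r) +
    Real.cos (θ r - θ q) with hG
  have hGd (q : ℝ) : HasDerivAt G (Real.sin (θ r - θ q) * (κ q - 1)) q := by
    have := ((((h.hasDerivAt_fst q).const_sub (X r)).mul_const (Real.sin (θ r))).sub
      (((h.hasDerivAt_snd q).const_sub (Y r)).mul_const (Real.cos (θ r)))).add
      ((h.hasDerivAt_angle q).const_sub (θ r)).cos
    refine this.congr_deriv ?_
    rw [Real.sin_sub]
    ring
  have hGc : Continuous G := continuous_iff_continuousAt.2 fun q ↦ (hGd q).continuousAt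
  have hlt : G s < G r := by
    rcases hrs.lt_or_gt with hlt | hlt
    · refine strictAntiOn_of_deriv_neg (convex_Icc r s) hGc.continuousOn (fun q hq ↦ ?_)
        (Set.left_mem_Icc.2 hlt.le) (Set.right_mem_Icc.2 hlt.le) hlt
      rw [interior_Icc] at hq
      rw [(hGd q).deriv]
      have h1 := h.strictMono_angle hq.1
      have h2 := h.strictMono_angle hq.2
      rw [h.angle_eq_zero] at h2
      exact mul_neg_of_neg_of_pos
        (Real.sin_neg_of_neg_of_neg_pi_lt (by linarith) (by linarith [hr.1]))
        (by linarith [h.one_lt_curvature q])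
    · refine strictMonoOn_of_deriv_pos (convex_Icc s r) hGc.continuousOn (fun q hq ↦ ?_)
        (Set.left_mem_Icc.2 hlt.le) (Set.right_mem_Icc.2 hlt.le) hlt
      rw [interior_Icc] at hq
      rw [(hGd q).deriv]
      have h1 := h.strictMono_angle hq.1
      have h2 := h.strictMono_angle hq.2
      rw [h.angle_eq_zero] at h1
      exact mul_pos (Real.sin_pos_of_pos_of_lt_pi (by linarith) (by linarith [hr.2]))
        (by linarith [h.one_lt_curvature q])
  simp only [hG, h.fst_eq_zero, h.snd_eq_zero, h.angle_eq_zero, sub_self, zero_mul, sub_zero,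
    zero_add, Real.cos_zero] at hlt
  linarith

/-- Blaschke's rolling theorem: away from the contact point, the set lies in the open unit disc
touching the arc from inside. -/
theorem lt_one_of_ne (h : IsBoundaryArc S X Y θ κ s) {p : ℝ × ℝ} (hp : p ∈ S) (hp0 : p ≠ 0) :
    p.1 ^ 2 + (p.2 - 1) ^ 2 < 1 := by
  by_contra! hge
  set z : ℂ := ⟨1 - p.2, p.1⟩ with hz
  have hnorm : 1 ≤ ‖z‖ := by
    rw [← abs_one, ← abs_of_nonneg (norm_nonneg z), ← sq_le_sq, Complex.sq_norm,
      Complex.normSq_apply]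
    simp only [hz]
    nlinarith
  have hcos : ‖z‖ * Real.cos z.arg = 1 - p.2 := Complex.norm_mul_cos_arg z
  have hsin : ‖z‖ * Real.sin z.arg = p.1 := Complex.norm_mul_sin_arg z
  obtain ⟨r, hr⟩ := h.surjective_angle z.arg
  have hsupp := h.support r p hp
  by_cases hrs : r = s
  · subst hrs
    simp only [h.angle_eq_zero, h.fst_eq_zero, h.snd_eq_zero, Real.sin_zero, Real.cos_zero] at *
    rw [← hr] at hcos hsin
    simp only [Real.sin_zero, Real.cos_zero] at hcos hsin
    exact hp0 (Prod.ext (by simp; linarith) (by simp; linarith))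
  · have hmem : θ r ∈ Set.Icc (-Real.pi) Real.pi :=
      hr ▸ Set.Ioc_subset_Icc_self (Complex.arg_mem_Ioc z)
    have hlt := h.support_lt hrs hmem
    rw [hr] at hsupp hlt
    have hone := Real.sin_sq_add_cos_sq z.arg
    have : p.1 * Real.sin z.arg + (1 - p.2) * Real.cos z.arg = ‖z‖ := by
      rw [← hcos, ← hsin]
      linear_combination ‖z‖ * hone
    linarith

/-- The disc-caps shrink to the contact point. -/
theorem eventually_abs_lt (h : IsBoundaryArc S X Y θ κ s) (hS : IsCompact S) {δ : ℝ}
    (hδ : 0 < δ) :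
    ∀ᶠ t in 𝓝[>] (0 : ℝ), ∀ p ∈ S, 1 ≤ p.1 ^ 2 + (p.2 - (1 + t)) ^ 2 → |p.1| < δ ∧ |p.2| < δ := by
  have key : ∀ᶠ t in 𝓝 (0 : ℝ), ∀ p ∈ S \ ball 0 δ, p.1 ^ 2 + (p.2 - (1 + t)) ^ 2 < 1 := by
    refine (hS.diff isOpen_ball).eventually_forall_of_forall_eventually fun p hp ↦ ?_
    refine ContinuousAt.eventually_lt (by fun_prop) continuousAt_const ?_
    simp only [add_zero]
    refine h.lt_one_of_ne hp.1 ?_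
    rintro rfl
    exact hp.2 (mem_ball_self hδ)
  filter_upwards [nhdsWithin_le_nhds key] with t ht p hp hge
  by_contra hcon
  refine hge.not_gt (ht p ⟨hp, fun hb ↦ hcon ?_⟩)
  rw [mem_ball_zero_iff, Prod.norm_def, max_lt_iff] at hb
  exact hb

theorem eventually_exists_fst_eq (h : IsBoundaryArc S X Y θ κ s) {P : ℝ → Prop}
    (hP : ∀ᶠ r in 𝓝 s, P r) : ∀ᶠ a in 𝓝 (0 : ℝ), ∃ r, P r ∧ X r = a := by
  have hX : HasStrictDerivAt X 1 s := by
    have := hasStrictDerivAt_of_hasDerivAt_of_continuousAt (x := s)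
      (Eventually.of_forall h.hasDerivAt_fst)
      (Real.continuous_cos.comp h.continuous_angle).continuousAt
    rwa [h.angle_eq_zero, Real.cos_zero] at this
  have := hX.map_nhds_eq one_ne_zero
  rw [h.fst_eq_zero] at this
  rw [← this, eventually_map]
  filter_upwards [hP] with r hr using ⟨r, hr, rfl⟩

theorem eventually_cos_pos (h : IsBoundaryArc S X Y θ κ s) : ∀ᶠ r in 𝓝 s, 0 < Real.cos (θ r) := by
  refine ContinuousAt.eventually_lt continuousAt_const
    (Real.continuous_cos.comp h.continuous_angle).continuousAt ?_
  simp [h.angle_eq_zero]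

theorem deriv_sq_add (h : IsBoundaryArc S X Y θ κ s) (c e : ℝ) :
    deriv (fun r ↦ c * X r ^ 2 + e * Y r) =
      fun r ↦ 2 * c * X r * Real.cos (θ r) + e * Real.sin (θ r) := by
  funext r
  have := (((h.hasDerivAt_fst r).pow 2).const_mul c).add ((h.hasDerivAt_snd r).const_mul e)
  refine (this.congr_deriv ?_).deriv
  simp
  ring

theorem deriv_deriv_sq_add (h : IsBoundaryArc S X Y θ κ s) (c e : ℝ) :
    deriv (deriv (fun r ↦ c * X r ^ 2 + e * Y r)) s = 2 * c + e * κ s := by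
  rw [h.deriv_sq_add]
  have := ((((h.hasDerivAt_fst s).const_mul (2 * c))).mul (h.hasDerivAt_angle s).cos).add
    ((h.hasDerivAt_angle s).sin.const_mul e)
  refine (this.congr_deriv ?_).deriv
  simp [h.angle_eq_zero, h.fst_eq_zero]

theorem eventually_parabola_nonneg (h : IsBoundaryArc S X Y θ κ s) {c e : ℝ}
    (hce : 0 < 2 * c + e * κ s) : ∀ᶠ r in 𝓝 s, 0 ≤ c * X r ^ 2 + e * Y r := by
  have hY : ContinuousAt Y s := (h.hasDerivAt_snd s).continuousAt
  have hX : ContinuousAt X s := (h.hasDerivAt_fst s).continuousAt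
  have := isLocalMin_of_deriv_deriv_pos (f := fun r ↦ c * X r ^ 2 + e * Y r) (x₀ := s)
    (by rwa [h.deriv_deriv_sq_add]) (by simp [h.deriv_sq_add, h.angle_eq_zero,
      h.fst_eq_zero]) (by fun_prop)
  filter_upwards [this] with r hr
  simpa [h.fst_eq_zero, h.snd_eq_zero] using hr

theorem eventually_le_snd (h : IsBoundaryArc S X Y θ κ s) {k : ℝ} (hk : k < κ s) :
    ∀ᶠ a in 𝓝 (0 : ℝ), ∀ b, (a, b) ∈ S → k / 2 * a ^ 2 ≤ b := by
  filter_upwards [h.eventually_exists_fst_eq (h.eventually_cos_pos.and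
    (h.eventually_parabola_nonneg (c := -(k / 2)) (e := 1) (by linarith)))] with a ha b hb
  obtain ⟨r, ⟨hcos, hpar⟩, rfl⟩ := ha
  have := h.support r _ hb
  simp only [sub_self, zero_mul] at this
  have := nonneg_of_mul_nonneg_left this hcos
  linarith

theorem exists_mem_of_le (h : IsBoundaryArc S X Y θ κ s) {k : ℝ} (hk : κ s < k) :
    ∃ δ > 0, ∀ a b : ℝ, |a| < δ → b < δ → k / 2 * a ^ 2 ≤ b → (a, b) ∈ S := by
  have hκ := h.one_lt_curvature s
  have hpos : ∀ᶠ r in 𝓝 s, X r ≠ 0 → 0 < Y r := by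
    filter_upwards [h.eventually_parabola_nonneg (c := -(1 / 2)) (e := 1) (by linarith)]
      with r hr hX
    have : 0 < X r ^ 2 := by positivity
    linarith
  have hex := h.eventually_exists_fst_eq hpos
  obtain ⟨a₁, ⟨r₁, hY₁, rfl⟩, ha₁ : 0 < X r₁⟩ :=
    ((hex.filter_mono (nhdsWithin_le_nhds (s := Set.Ioi 0))).and self_mem_nhdsWithin).exists
  obtain ⟨a₂, ⟨r₂, hY₂, rfl⟩, ha₂ : X r₂ < 0⟩ :=
    ((hex.filter_mono (nhdsWithin_le_nhds (s := Set.Iio 0))).and self_mem_nhdsWithin).exists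
  have hY₁ := hY₁ ha₁.ne'
  have hY₂ := hY₂ ha₂.ne
  obtain ⟨ε, hε, hball⟩ := Metric.eventually_nhds_iff.1 (h.eventually_exists_fst_eq
    (h.eventually_parabola_nonneg (c := k / 2) (e := -1) (by linarith)))
  refine ⟨min ε (min (min (X r₁) (-X r₂)) (min (Y r₁) (Y r₂))), by
    simp only [gt_iff_lt, lt_min_iff]; exact ⟨hε, ⟨ha₁, by linarith⟩, hY₁, hY₂⟩, ?_⟩
  intro a b ha hb hab
  simp only [lt_min_iff, abs_lt] at ha hb
  obtain ⟨r, hr, hra⟩ := hball (y := a) (by simpa [abs_lt] using ha.1)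
  have hlow : (a, Y r) ∈ S := hra ▸ h.mem r
  have hYb : Y r ≤ b := by rw [hra] at hr; linarith
  have hD : 0 < X r₁ - X r₂ := by linarith
  have hc₁ : 0 ≤ (a - X r₂) / (X r₁ - X r₂) := div_nonneg (by linarith) hD.le
  have hc₂ : 0 ≤ (X r₁ - a) / (X r₁ - X r₂) := div_nonneg (by linarith) hD.le
  have hc : (a - X r₂) / (X r₁ - X r₂) + (X r₁ - a) / (X r₁ - X r₂) = 1 := by
    field_simp
    ring
  have htop := h.convex (h.mem r₁) (h.mem r₂) hc₁ hc₂ hc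
  set c₁ := (a - X r₂) / (X r₁ - X r₂)
  set c₂ := (X r₁ - a) / (X r₁ - X r₂)
  have hX : c₁ * X r₁ + c₂ * X r₂ = a := by
    simp only [c₁, c₂]
    field_simp
    ring
  simp only [Prod.smul_mk, smul_eq_mul, Prod.mk_add_mk, hX] at htop
  have hbtop : b ≤ c₁ * Y r₁ + c₂ * Y r₂ := by nlinarith [hb.2.2.1, hb.2.2.2]
  obtain ⟨v, hv, hvb⟩ : b ∈ Set.image Prod.snd
      (segment ℝ (a, Y r) (a, c₁ * Y r₁ + c₂ * Y r₂)) := by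
    have := segment_eq_Icc (𝕜 := ℝ) (hYb.trans hbtop)
    have := Set.ext_iff.1 this b
    rw [← LinearMap.coe_snd (R := ℝ), ← LinearMap.coe_toAffineMap, image_segment]
    exact this.2 ⟨hYb, hbtop⟩
  have hva : v.1 = a := by
    obtain ⟨c, d, hc, hd, hcd, rfl⟩ := hv
    simp [← add_mul, hcd]
  rw [← hva, ← hvb]
  exact h.convex.segment_subset hlow htop hv

/-- The area of the disc-caps is asymptotic to that of the parabolic region. -/
theorem tendsto_volume_cap (h : IsBoundaryArc S X Y θ κ s) (hS : IsCompact S) :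
    Tendsto (fun t : ℝ ↦
      (volume {p | p ∈ S ∧ 1 ≤ p.1 ^ 2 + (p.2 - (1 + t)) ^ 2}).toReal / t ^ ((3 : ℝ) / 2))
      (𝓝[>] 0) (𝓝 (4 / 3 * √(2 / (κ s - 1)))) := by
  have hκ := h.one_lt_curvature s
  have hcont : ContinuousAt (fun d : ℝ ↦ 4 / 3 * √(2 / d)) (κ s - 1) :=
    continuousAt_const.mul (continuousAt_const.div continuousAt_id (by simp; linarith)).sqrt
  have htpos : ∀ᶠ t in 𝓝[>] (0 : ℝ), 0 < t := self_mem_nhdsWithin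
  have hfin (t : ℝ) : volume {p | p ∈ S ∧ 1 ≤ p.1 ^ 2 + (p.2 - (1 + t)) ^ 2} ≠ ⊤ :=
    measure_ne_top_of_subset (fun p hp ↦ hp.1) hS.measure_ne_top
  refine tendsto_order.2 ⟨fun c hc ↦ ?_, fun c hc ↦ ?_⟩
  · obtain ⟨d, hdc, hd : κ s - 1 < d⟩ :=
      (((hcont.eventually (lt_mem_nhds hc)).filter_mono
        (nhdsWithin_le_nhds (s := Set.Ioi (κ s - 1)))).and self_mem_nhdsWithin).exists
    have hd0 : 0 < d := by linarith
    obtain ⟨δ, hδ, hmem⟩ := h.exists_mem_of_le (k := d + 1) (by linarith)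
    have hsmall : ∀ᶠ t in 𝓝[>] (0 : ℝ), 2 * t / d < min δ 1 ^ 2 ∧ t + t / d < min δ 1 := by
      refine nhdsWithin_le_nhds (Eventually.and ?_ ?_)
      · exact ContinuousAt.eventually_lt (by fun_prop) continuousAt_const (by simp; positivity)
      · exact ContinuousAt.eventually_lt (by fun_prop) continuousAt_const (by simp [hδ])
    filter_upwards [htpos, hsmall] with t ht hts
    have hsub : {p : ℝ × ℝ | (d + 1) / 2 * p.1 ^ 2 ≤ p.2 ∧ p.2 ≤ t + 1 / 2 * p.1 ^ 2} ⊆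
        {p | p ∈ S ∧ 1 ≤ p.1 ^ 2 + (p.2 - (1 + t)) ^ 2} := by
      rintro ⟨a, b⟩ ⟨h1, h2⟩
      simp only at h1 h2
      have ha : a ^ 2 ≤ 2 * t / d := by
        rw [le_div_iff₀ hd0]
        linarith
      have haδ : |a| < min δ 1 := abs_lt_of_sq_lt_sq (ha.trans_lt hts.1) (by positivity)
      have hb : b < min δ 1 := by
        refine lt_of_le_of_lt ?_ hts.2
        have : 2 * t / d = 2 * (t / d) := by ring
        linarith
      rw [lt_min_iff] at haδ hb
      refine ⟨hmem a b haδ.1 hb.1 h1, ?_⟩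
      simp only
      have ha1 : a ^ 2 < 1 := by
        rw [← sq_abs]
        nlinarith [abs_nonneg a]
      nlinarith [sq_nonneg (1 - a ^ 2 / 2)]
    have hvol := measure_mono (μ := volume) hsub
    rw [volume_between_parabolas (by linarith) ht, ENNReal.ofReal_le_iff_le_toReal (hfin t)] at hvol
    rw [lt_div_iff₀ (by positivity)]
    refine lt_of_lt_of_le ?_ hvol
    rw [add_sub_cancel_right]
    gcongr
  · obtain ⟨d, ⟨hdc, hd0⟩, hd : d < κ s - 1⟩ :=
      ((((hcont.eventually (gt_mem_nhds hc)).and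
        (lt_mem_nhds (show 0 < κ s - 1 by linarith))).filter_mono
        (nhdsWithin_le_nhds (s := Set.Iio (κ s - 1)))).and self_mem_nhdsWithin).exists
    set η : ℝ := (κ s - 1 - d) / 2 with hη
    have hη0 : 0 < η := by linarith
    obtain ⟨ε, hε, hlow⟩ :=
      Metric.eventually_nhds_iff.1 (h.eventually_le_snd (k := 1 + η + d) (by linarith))
    have hδ : 0 < min (min ε (1 / 2)) (√(η / (1 + η) ^ 2)) := by positivity
    filter_upwards [htpos, h.eventually_abs_lt hS hδ] with t ht hloc
    have hsub : {p | p ∈ S ∧ 1 ≤ p.1 ^ 2 + (p.2 - (1 + t)) ^ 2} ⊆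
        {p : ℝ × ℝ | (1 + η + d) / 2 * p.1 ^ 2 ≤ p.2 ∧ p.2 ≤ t + (1 + η) / 2 * p.1 ^ 2} := by
      rintro ⟨a, b⟩ ⟨hpS, hge⟩
      obtain ⟨ha, hb⟩ := hloc _ hpS hge
      simp only [lt_min_iff] at ha hb hge ⊢
      refine ⟨hlow (by simpa using ha.1.1) b hpS, ?_⟩
      by_contra! hlt
      simp only at hlt
      have haη : (1 + η) ^ 2 * a ^ 2 < η := by
        have := (Real.lt_sqrt (abs_nonneg a)).1 ha.2
        rw [sq_abs, lt_div_iff₀ (by positivity)] at this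
        linarith
      have hb1 := abs_lt.1 hb.1.2
      have h1 : 0 < 1 + t - b := by linarith
      have h2 : 1 + t - b < 1 - (1 + η) / 2 * a ^ 2 := by linarith
      have h3 : (1 + t - b) ^ 2 < (1 - (1 + η) / 2 * a ^ 2) ^ 2 := by gcongr
      nlinarith [mul_le_mul_of_nonneg_left haη.le (sq_nonneg a), mul_nonneg hη0.le (sq_nonneg a)]
    have hvol := measure_mono (μ := volume) hsub
    rw [volume_between_parabolas (by linarith) ht, add_sub_cancel_left] at hvol
    have := ENNReal.toReal_le_of_le_ofReal (by positivity) hvol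
    rw [div_lt_iff₀ (by positivity)]
    refine this.trans_lt ?_
    gcongr

end IsBoundaryArc

/-- Euclidean coordinates centred at `x` along the orthonormal frame `(a, b)`, `(-b, a)` preserve
the area. -/
theorem volume_preimage_frame (x : EuclideanSpace ℝ (Fin 2)) {a b : ℝ} (hab : a ^ 2 + b ^ 2 = 1)
    (C : Set (EuclideanSpace ℝ (Fin 2))) :
    volume ((fun p : ℝ × ℝ ↦ x + !₂[a * p.1 - b * p.2, b * p.1 + a * p.2]) ⁻¹' C) = volume C := by
  have hon : Orthonormal ℝ ![!₂[a, b], !₂[-b, a]] := by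
    rw [orthonormal_iff_ite]
    intro i j
    fin_cases i <;> fin_cases j <;> simp [PiLp.inner_apply, -inner_self_eq_norm_sq_to_K] <;>
      linarith
  have hspan : Submodule.span ℝ (Set.range ![!₂[a, b], !₂[-b, a]]) = ⊤ :=
    hon.linearIndependent.span_eq_top_of_card_eq_finrank (by simp)
  set e := OrthonormalBasis.mk hon hspan.ge with he
  set F : ℝ × ℝ ≃ᵐ EuclideanSpace ℝ (Fin 2) :=
    ((MeasurableEquiv.finTwoArrow.symm.trans (MeasurableEquiv.toLp 2 (Fin 2 → ℝ))).trans
      e.measurableEquiv.symm).trans (MeasurableEquiv.addLeft x) with hF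
  have hFp : MeasurePreserving F volume volume :=
    ((((volume_preserving_finTwoArrow ℝ).symm _).trans (PiLp.volume_preserving_toLp (Fin 2))).trans
      e.measurePreserving_repr_symm).trans (measurePreserving_add_left volume x)
  have hFe : (fun p : ℝ × ℝ ↦ x + !₂[a * p.1 - b * p.2, b * p.1 + a * p.2]) = F := by
    funext p
    change _ = x + e.repr.symm (WithLp.toLp 2 ![p.1, p.2])
    rw [← e.sum_repr_symm]
    congr 1
    ext i
    fin_cases i <;> simp [he] <;> ring
  rw [hFe]
  exact hFp.measure_preimage_equiv C

section Frenet

variable {γ : ℝ → EuclideanSpace ℝ (Fin 2)}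

theorem hasDerivAt_coord_of_contDiff (hγ : ContDiff ℝ 2 γ) (i : Fin 2) (r : ℝ) :
    HasDerivAt (fun q ↦ γ q i) (deriv γ r i) r :=
  (EuclideanSpace.proj (𝕜 := ℝ) i).hasFDerivAt.comp_hasDerivAt r
    (hγ.differentiable (by norm_num) r).hasDerivAt

theorem hasDerivAt_deriv_coord_of_contDiff (hγ : ContDiff ℝ 2 γ) (i : Fin 2) (r : ℝ) :
    HasDerivAt (fun q ↦ deriv γ q i) (deriv (deriv γ) r i) r :=
  (EuclideanSpace.proj (𝕜 := ℝ) i).hasFDerivAt.comp_hasDerivAt r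
    (hγ.differentiable_deriv_two r).hasDerivAt

theorem deriv_coord_sq_add_sq (hspeed : ∀ r, ‖deriv γ r‖ = 1) (r : ℝ) :
    deriv γ r 0 ^ 2 + deriv γ r 1 ^ 2 = 1 := by
  have := EuclideanSpace.real_norm_sq_eq (deriv γ r)
  rw [hspeed, Fin.sum_univ_two] at this
  linarith

/-- The Frenet equations of a planar curve parametrized by arc length. -/
theorem frenet (hγ : ContDiff ℝ 2 γ) (hspeed : ∀ r, ‖deriv γ r‖ = 1) {κ : ℝ → ℝ}
    (hκ : ∀ r, κ r = deriv γ r 0 * deriv (deriv γ) r 1 - deriv γ r 1 * deriv (deriv γ) r 0)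
    (r : ℝ) :
    deriv (deriv γ) r 0 = -κ r * deriv γ r 1 ∧ deriv (deriv γ) r 1 = κ r * deriv γ r 0 := by
  have hone := deriv_coord_sq_add_sq hspeed r
  have horth :
      2 * deriv γ r 0 * deriv (deriv γ) r 0 + 2 * deriv γ r 1 * deriv (deriv γ) r 1 = 0 := by
    have h1 := ((hasDerivAt_deriv_coord_of_contDiff hγ 0 r).pow 2).add
      ((hasDerivAt_deriv_coord_of_contDiff hγ 1 r).pow 2)
    have h2 : ((fun q ↦ deriv γ q 0) ^ 2 + (fun q ↦ deriv γ q 1) ^ 2) = fun _ ↦ (1 : ℝ) :=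
      funext fun q ↦ deriv_coord_sq_add_sq hspeed q
    rw [h2] at h1
    have := h1.unique (hasDerivAt_const r (1 : ℝ))
    simpa using this
  rw [hκ]
  constructor
  · linear_combination (-deriv (deriv γ) r 0) * hone + (deriv γ r 0 / 2) * horth
  · linear_combination (-deriv (deriv γ) r 1) * hone + (deriv γ r 1 / 2) * horth

/-- The tangent of a planar curve parametrized by arc length turns by the integral of the
curvature. -/
theorem deriv_eq_rotation (hγ : ContDiff ℝ 2 γ) (hspeed : ∀ r, ‖deriv γ r‖ = 1) {κ θ : ℝ → ℝ}
    (hκ : ∀ r, κ r = deriv γ r 0 * deriv (deriv γ) r 1 - deriv γ r 1 * deriv (deriv γ) r 0)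
    (hθ : ∀ r, HasDerivAt θ (κ r) r) {s : ℝ} (hs : θ s = 0) (r : ℝ) :
    deriv γ r 0 = deriv γ s 0 * Real.cos (θ r) - deriv γ s 1 * Real.sin (θ r) ∧
      deriv γ r 1 = deriv γ s 1 * Real.cos (θ r) + deriv γ s 0 * Real.sin (θ r) := by
  have hC (q : ℝ) : HasDerivAt
      (fun q ↦ deriv γ q 0 * Real.cos (θ q) + deriv γ q 1 * Real.sin (θ q)) 0 q := by
    have := ((hasDerivAt_deriv_coord_of_contDiff hγ 0 q).mul (hθ q).cos).add
      ((hasDerivAt_deriv_coord_of_contDiff hγ 1 q).mul (hθ q).sin)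
    refine this.congr_deriv ?_
    rw [(frenet hγ hspeed hκ q).1, (frenet hγ hspeed hκ q).2]
    ring
  have hD (q : ℝ) : HasDerivAt
      (fun q ↦ deriv γ q 1 * Real.cos (θ q) - deriv γ q 0 * Real.sin (θ q)) 0 q := by
    have := ((hasDerivAt_deriv_coord_of_contDiff hγ 1 q).mul (hθ q).cos).sub
      ((hasDerivAt_deriv_coord_of_contDiff hγ 0 q).mul (hθ q).sin)
    refine this.congr_deriv ?_
    rw [(frenet hγ hspeed hκ q).1, (frenet hγ hspeed hκ q).2]
    ring
  have hC' := is_const_of_deriv_eq_zero (fun q ↦ (hC q).differentiableAt) (fun q ↦ (hC q).deriv) r s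
  have hD' := is_const_of_deriv_eq_zero (fun q ↦ (hD q).differentiableAt) (fun q ↦ (hD q).deriv) r s
  simp only [hs, Real.cos_zero, Real.sin_zero] at hC' hD'
  have hone := Real.sin_sq_add_cos_sq (θ r)
  constructor
  · linear_combination Real.cos (θ r) * hC' - Real.sin (θ r) * hD' - deriv γ r 0 * hone
  · linear_combination Real.sin (θ r) * hC' + Real.cos (θ r) * hD' - deriv γ r 1 * hone

/-- A unit vector supporting a positively curved arc at `γ r` is the right-hand normal. -/
theorem eq_normal_of_support (hγ : ContDiff ℝ 2 γ) (hspeed : ∀ r, ‖deriv γ r‖ = 1) {κ : ℝ → ℝ}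
    (hκ : ∀ r, κ r = deriv γ r 0 * deriv (deriv γ) r 1 - deriv γ r 1 * deriv (deriv γ) r 0)
    {r : ℝ} (hpos : 0 < κ r) {v : EuclideanSpace ℝ (Fin 2)} (hv : ‖v‖ = 1)
    (hsupp : ∀ q, ⟪γ q - γ r, v⟫ ≤ 0) : v 0 = deriv γ r 1 ∧ v 1 = -deriv γ r 0 := by
  set f : ℝ → ℝ := fun q ↦ (γ q 0 - γ r 0) * v 0 + (γ q 1 - γ r 1) * v 1 with hf
  have hf0 (q : ℝ) : f q ≤ 0 := by
    have := hsupp q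
    simp only [PiLp.inner_apply, Fin.sum_univ_two, PiLp.sub_apply, RCLike.inner_apply,
      conj_trivial] at this
    simp only [hf]
    linarith
  have hfr : f r = 0 := by simp [hf]
  have hfd (q : ℝ) : HasDerivAt f (deriv γ q 0 * v 0 + deriv γ q 1 * v 1) q :=
    (((hasDerivAt_coord_of_contDiff hγ 0 q).sub_const _).mul_const _).add
      (((hasDerivAt_coord_of_contDiff hγ 1 q).sub_const _).mul_const _)
  have hdf : deriv f = fun q ↦ deriv γ q 0 * v 0 + deriv γ q 1 * v 1 := funext fun q ↦ (hfd q).deriv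
  have hddf : deriv (deriv f) r = κ r * (deriv γ r 0 * v 1 - deriv γ r 1 * v 0) := by
    rw [hdf]
    have := ((hasDerivAt_deriv_coord_of_contDiff hγ 0 r).mul_const (v 0)).add
      ((hasDerivAt_deriv_coord_of_contDiff hγ 1 r).mul_const (v 1))
    refine (this.congr_deriv ?_).deriv
    rw [(frenet hγ hspeed hκ r).1, (frenet hγ hspeed hκ r).2]
    ring
  have hmax : IsLocalMax f r := Eventually.of_forall fun q ↦ by rw [hfr]; exact hf0 q
  have hcrit := hmax.deriv_eq_zero
  have hnonpos : deriv (deriv f) r ≤ 0 := by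
    by_contra! hlt
    have hmin := isLocalMin_of_deriv_deriv_pos hlt hcrit (hfd r).continuousAt
    have hconst : f =ᶠ[𝓝 r] fun _ ↦ (0 : ℝ) := by
      filter_upwards [hmin] with q hq using le_antisymm (hf0 q) (hfr ▸ hq)
    have := hconst.deriv.deriv_eq
    simp at this
    linarith
  rw [hddf] at hnonpos
  have hsign : deriv γ r 0 * v 1 - deriv γ r 1 * v 0 ≤ 0 := by
    by_contra! hlt
    exact hnonpos.not_gt (mul_pos hpos hlt)
  rw [hdf] at hcrit
  simp only at hcrit
  have hone := deriv_coord_sq_add_sq hspeed r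
  have hv1 : v 0 ^ 2 + v 1 ^ 2 = 1 := by
    have := EuclideanSpace.real_norm_sq_eq v
    rw [hv, Fin.sum_univ_two] at this
    linarith
  have hcross : deriv γ r 0 * v 1 - deriv γ r 1 * v 0 = -1 := by
    have hsq : (deriv γ r 0 * v 1 - deriv γ r 1 * v 0) ^ 2 = 1 := by
      linear_combination (v 0 ^ 2 + v 1 ^ 2) * hone + hv1 -
        (deriv γ r 0 * v 0 + deriv γ r 1 * v 1) * hcrit
    rcases sq_eq_sq_iff_eq_or_eq_neg.1 (hsq.trans (one_pow 2).symm) with h | h <;> linarith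
  constructor
  · linear_combination deriv γ r 0 * hcrit - deriv γ r 1 * hcross - v 0 * hone
  · linear_combination deriv γ r 1 * hcrit + deriv γ r 0 * hcross - v 1 * hone

end Frenet

/-- For a planar convex body `K` with `C²` boundary and curvature `κ > 1` everywhere,
the area `A(u_x, t)` of the disc-cap of height `t` with vertex `x = γ s` satisfies
`lim_{t→0⁺} A(u_x,t) · t^{-3/2} = (4/3)·√(2/(κ(x)-1))`. -/
theorem disc_cap_area_limit
    (K : Set (EuclideanSpace ℝ (Fin 2)))
    (hKcomp : IsCompact K) (hKconv : Convex ℝ K) (hKint : (interior K).Nonempty)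
    (γ : ℝ → EuclideanSpace ℝ (Fin 2)) (hγ : ContDiff ℝ 2 γ)
    (hγspeed : ∀ s, ‖deriv γ s‖ = 1)
    (hγrange : frontier K = Set.range γ)
    (κ : ℝ → ℝ)
    (hκdef : ∀ s, κ s =
      deriv γ s 0 * deriv (deriv γ) s 1 - deriv γ s 1 * deriv (deriv γ) s 0)
    (hκ : ∀ s, 1 < κ s)
    (u : EuclideanSpace ℝ (Fin 2) → EuclideanSpace ℝ (Fin 2))
    (hu : ∀ x ∈ frontier K, ‖u x‖ = 1 ∧ ∀ y ∈ K, ⟪y - x, u x⟫ ≤ 0)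
    (huniq : ∀ x ∈ frontier K, ∀ v, ‖v‖ = 1 → (∀ y ∈ K, ⟪y - x, v⟫ ≤ 0) → v = u x)
    (s : ℝ) :
    Tendsto
      (fun t : ℝ =>
        (volume (K \ ball (γ s - (1 + t) • u (γ s)) 1)).toReal / t ^ ((3 : ℝ) / 2))
      (𝓝[>] 0) (𝓝 (4 / 3 * Real.sqrt (2 / (κ s - 1)))) := by
  have hKfr : frontier K ⊆ K := hKcomp.isClosed.frontier_subset
  have hγK (r : ℝ) : γ r ∈ frontier K := hγrange ▸ Set.mem_range_self r
  have hn (r : ℝ) : u (γ r) 0 = deriv γ r 1 ∧ u (γ r) 1 = -deriv γ r 0 :=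
    eq_normal_of_support hγ hγspeed hκdef (by linarith [hκ r]) (hu _ (hγK r)).1
      fun q ↦ (hu _ (hγK r)).2 _ (hKfr (hγK q))
  have hκcont : Continuous κ := by
    have hT : Continuous (deriv γ) := hγ.differentiable_deriv_two.continuous
    have hT' : Continuous (deriv (deriv γ)) :=
      (hγ.iterate_deriv' 0 2).continuous
    rw [funext hκdef]
    fun_prop
  set θ : ℝ → ℝ := fun r ↦ ∫ q in s..r, κ q with hθ
  have hθd (r : ℝ) : HasDerivAt θ (κ r) r := hκcont.integral_hasStrictDerivAt s r |>.hasDerivAt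
  have hθs : θ s = 0 := intervalIntegral.integral_same
  have hrot := deriv_eq_rotation hγ hγspeed hκdef hθd hθs
  have hone := deriv_coord_sq_add_sq hγspeed s
  set a := deriv γ s 0
  set b := deriv γ s 1
  set P : ℝ × ℝ → EuclideanSpace ℝ (Fin 2) :=
    fun p ↦ γ s + !₂[a * p.1 - b * p.2, b * p.1 + a * p.2] with hP
  set Q : EuclideanSpace ℝ (Fin 2) → ℝ × ℝ := fun y ↦
    (a * (y 0 - γ s 0) + b * (y 1 - γ s 1), a * (y 1 - γ s 1) - b * (y 0 - γ s 0)) with hQ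
  have hPQ : Function.LeftInverse P Q := fun y ↦ by
    ext i
    fin_cases i <;> simp [hP, hQ]
    · linear_combination (y 0 - γ s 0) * hone
    · linear_combination (y 1 - γ s 1) * hone
  have hQP : Function.RightInverse P Q := fun p ↦ by
    ext <;> simp [hP, hQ]
    · linear_combination p.1 * hone
    · linear_combination p.2 * hone
  have hScomp : IsCompact (P ⁻¹' K) := by
    rw [← Set.image_eq_preimage_of_inverse hPQ hQP]
    exact hKcomp.image (by fun_prop)
  have harc : IsBoundaryArc (P ⁻¹' K) (fun r ↦ (Q (γ r)).1) (fun r ↦ (Q (γ r)).2) θ κ s := by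
    refine ⟨?_, hκcont, hκ, hθd, fun r ↦ ?_, fun r ↦ ?_, by simp [hQ], by simp [hQ], hθs,
      fun r ↦ ?_, fun r p hp ↦ ?_⟩
    · intro p hp q hq c d hc hd hcd
      have : P (c • p + d • q) = c • P p + d • P q := by
        ext i
        fin_cases i <;> simp [hP]
        · linear_combination (-γ s 0) * hcd
        · linear_combination (-γ s 1) * hcd
      rw [Set.mem_preimage, this]
      exact hKconv hp hq hc hd hcd
    · have := (((hasDerivAt_coord_of_contDiff hγ 0 r).sub_const (γ s 0)).const_mul a).add
        (((hasDerivAt_coord_of_contDiff hγ 1 r).sub_const (γ s 1)).const_mul b)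
      refine this.congr_deriv ?_
      rw [(hrot r).1, (hrot r).2]
      linear_combination Real.cos (θ r) * hone
    · have := (((hasDerivAt_coord_of_contDiff hγ 1 r).sub_const (γ s 1)).const_mul a).sub
        (((hasDerivAt_coord_of_contDiff hγ 0 r).sub_const (γ s 0)).const_mul b)
      refine this.congr_deriv ?_
      rw [(hrot r).1, (hrot r).2]
      linear_combination Real.sin (θ r) * hone
    · change P (Q (γ r)) ∈ K
      rw [hPQ]
      exact hKfr (hγK r)
    · have hsupp := (hu _ (hγK r)).2 _ hp
      simp only [PiLp.inner_apply, Fin.sum_univ_two, PiLp.sub_apply, RCLike.inner_apply,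
        conj_trivial, (hn r).1, (hn r).2, (hrot r).1, (hrot r).2] at hsupp
      simp [hP] at hsupp
      simp only [hQ]
      linear_combination hsupp + (p.2 * Real.cos (θ r) - p.1 * Real.sin (θ r)) * hone
  refine (harc.tendsto_volume_cap hScomp).congr fun t ↦ ?_
  rw [← volume_preimage_frame (γ s) hone]
  congr 3
  ext p
  simp only [Set.mem_ofPred_eq, Set.mem_preimage, Set.mem_sdiff, mem_ball, not_lt]
  refine and_congr_right fun _ ↦ ?_
  rw [EuclideanSpace.dist_eq, Real.one_le_sqrt, Fin.sum_univ_two, Real.dist_eq, Real.dist_eq,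
    sq_abs, sq_abs]
  have hb : u (γ s) 0 = b := (hn s).1
  have ha : u (γ s) 1 = -a := (hn s).2
  simp only [PiLp.add_apply, PiLp.sub_apply, PiLp.smul_apply, smul_eq_mul, ha, hb,
    Matrix.cons_val_zero, Matrix.cons_val_one]
  have : (γ s 0 + (a * p.1 - b * p.2) - (γ s 0 - (1 + t) * b)) ^ 2 +
      (γ s 1 + (b * p.1 + a * p.2) - (γ s 1 - (1 + t) * -a)) ^ 2 =
      p.1 ^ 2 + (p.2 - (1 + t)) ^ 2 := by
    linear_combination (p.1 ^ 2 + (p.2 - (1 + t)) ^ 2) * hone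
  rw [this]
end

section
/- Let K ⊂ ℝ² be a convex body with C² boundary, minimal curvature κ_m, and let r > 1/κ_m. Then the r-dual body K^{*,r} = {x ∈ ℝ² : K ⊆ rB² + x} satisfies h_K(u) + h_{K^{*,r}}(−u) = r for every u ∈ S¹, where h denotes the support function. -/
open Metric
open scoped RealInnerProductSpace

/-- A unit-speed moving frame `(a, b)` rotating with angular velocity `κ` has an angle function. -/
lemma exists_angle_s8 {a b κ : ℝ → ℝ} (hκ : Continuous κ)
    (ha : ∀ t, HasDerivAt a (-(κ t * b t)) t) (hb : ∀ t, HasDerivAt b (κ t * a t) t)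
    (hab : ∀ t, a t ^ 2 + b t ^ 2 = 1) :
    ∃ θ : ℝ → ℝ, (∀ t, HasDerivAt θ (κ t) t) ∧
      ∀ t, a t = Real.cos (θ t) ∧ b t = Real.sin (θ t) := by
  obtain ⟨θ₀, hc₀, hs₀⟩ : ∃ θ₀, a 0 = Real.cos θ₀ ∧ b 0 = Real.sin θ₀ := by
    have hn : ‖(⟨a 0, b 0⟩ : ℂ)‖ = 1 := by
      rw [Complex.norm_def, Complex.normSq_mk, Real.sqrt_eq_one]
      linarith [hab 0]
    refine ⟨Complex.arg ⟨a 0, b 0⟩, ?_, ?_⟩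
    · rw [Complex.cos_arg (by rw [← norm_ne_zero_iff, hn]; exact one_ne_zero), hn, div_one]
    · rw [Complex.sin_arg, hn, div_one]
  set θ : ℝ → ℝ := fun t => θ₀ + ∫ s in (0 : ℝ)..t, κ s with hθ_def
  have hθ : ∀ t, HasDerivAt θ (κ t) t := fun t =>
    (intervalIntegral.integral_hasDerivAt_right (hκ.intervalIntegrable _ _)
      hκ.aestronglyMeasurable.stronglyMeasurableAtFilter hκ.continuousAt).const_add θ₀
  have hθ0 : θ 0 = θ₀ := by simp [hθ_def]
  have hP : ∀ t, HasDerivAt (fun t => a t * Real.cos (θ t) + b t * Real.sin (θ t)) 0 t := by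
    intro t
    refine (((ha t).mul (hθ t).cos).add ((hb t).mul (hθ t).sin)).congr_deriv ?_
    ring
  have hQ : ∀ t, HasDerivAt (fun t => b t * Real.cos (θ t) - a t * Real.sin (θ t)) 0 t := by
    intro t
    refine (((hb t).mul (hθ t).cos).sub ((ha t).mul (hθ t).sin)).congr_deriv ?_
    ring
  refine ⟨θ, hθ, fun t => ?_⟩
  have h1 := is_const_of_deriv_eq_zero (fun t => (hP t).differentiableAt)
    (fun t => (hP t).deriv) t 0
  have h2 := is_const_of_deriv_eq_zero (fun t => (hQ t).differentiableAt)
    (fun t => (hQ t).deriv) t 0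
  simp only [hθ0, hc₀, hs₀] at h1 h2
  have h3 := Real.sin_sq_add_cos_sq (θ t)
  have h4 := Real.sin_sq_add_cos_sq θ₀
  constructor
  · linear_combination Real.cos (θ t) * h1 - Real.sin (θ t) * h2 - a t * h3
      + Real.cos (θ t) * h4
  · linear_combination Real.sin (θ t) * h1 + Real.cos (θ t) * h2 - b t * h3
      + Real.sin (θ t) * h4

/-- At a local maximum the second derivative is nonpositive. -/
lemma IsLocalMax.second_deriv_nonpos {g g' : ℝ → ℝ} {c s : ℝ} (hmax : IsLocalMax g s)
    (hg : ∀ t, HasDerivAt g (g' t) t) (hg' : HasDerivAt g' c s) : c ≤ 0 := by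
  by_contra! hc
  have hd : deriv g = g' := funext fun t => (hg t).deriv
  have hmin : IsLocalMin g s := isLocalMin_of_deriv_deriv_pos
    (by rwa [hd, hg'.deriv]) hmax.deriv_eq_zero (hg s).continuousAt
  have hconst : g =ᶠ[nhds s] fun _ => g s := by
    filter_upwards [hmax, hmin] with t h1 h2 using le_antisymm h1 h2
  have h0 : g' =ᶠ[nhds s] fun _ => 0 := by
    have := hconst.deriv
    rw [hd] at this
    filter_upwards [this] with t ht
    simpa using ht
  have : c = 0 := hg'.unique ((hasDerivAt_const s (0 : ℝ)).congr_of_eventuallyEq h0)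
  exact hc.ne' this

/-- Every boundary point of a convex body in a Hilbert space has a unit outer normal. -/
lemma exists_unit_normal {E : Type*} [NormedAddCommGroup E] [InnerProductSpace ℝ E]
    [CompleteSpace E] {K : Set E} (hK : Convex ℝ K)
    (hint : (interior K).Nonempty) {p : E} (hp : p ∈ frontier K) :
    ∃ u : E, ‖u‖ = 1 ∧ ∀ x ∈ K, ⟪x, u⟫ ≤ ⟪p, u⟫ := by
  obtain ⟨f, hf⟩ := geometric_hahn_banach_open_point hK.interior isOpen_interior hp.2
  set w := (InnerProductSpace.toDual ℝ E).symm f with hw_def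
  have hw : ∀ x, ⟪x, w⟫ = f x := fun x => by
    rw [real_inner_comm, hw_def, InnerProductSpace.toDual_symm_apply]
  have hw0 : w ≠ 0 := by
    obtain ⟨q, hq⟩ := hint
    intro h0
    have := hf q hq
    rw [← hw, ← hw, h0, inner_zero_right, inner_zero_right] at this
    exact lt_irrefl _ this
  have hle : ∀ x ∈ K, f x ≤ f p := by
    intro x hx
    have hx' : x ∈ closure (interior K) := by
      rw [hK.closure_interior_eq_closure_of_nonempty_interior hint]
      exact subset_closure hx
    exact closure_minimal (fun y hy => (hf y hy).le)
      (isClosed_le f.continuous continuous_const) hx'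
  refine ⟨‖w‖⁻¹ • w, norm_smul_inv_norm hw0, fun x hx => ?_⟩
  rw [inner_smul_right, inner_smul_right, hw, hw]
  exact mul_le_mul_of_nonneg_left (hle x hx) (by positivity)

/-- A maximizer over `K` of a nonzero linear functional lies on the boundary of `K`. -/
lemma mem_frontier_of_forall_inner_le {E : Type*} [NormedAddCommGroup E] [InnerProductSpace ℝ E]
    {K : Set E} {u p : E} (hu : u ≠ 0) (hp : p ∈ K) (hmax : ∀ x ∈ K, ⟪x, u⟫ ≤ ⟪p, u⟫) :
    p ∈ frontier K := by
  refine ⟨subset_closure hp, fun hpi => ?_⟩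
  have hc : Filter.Tendsto (fun t : ℝ => p + t • u) (nhdsWithin 0 (Set.Ioi 0)) (nhds p) := by
    have : Continuous fun t : ℝ => p + t • u := by fun_prop
    simpa using (this.tendsto 0).mono_left nhdsWithin_le_nhds
  obtain ⟨t, ht, ht0⟩ := ((hc.eventually (mem_interior_iff_mem_nhds.1 hpi)).and
    self_mem_nhdsWithin).exists
  have h := hmax _ ht
  rw [inner_add_left, inner_smul_left] at h
  have h1 : 0 < ⟪u, u⟫ := real_inner_self_pos.2 hu
  have h2 : 0 < t * ⟪u, u⟫ := mul_pos ht0 h1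
  simp only [conj_trivial] at h
  linarith

/-- A unit vector is the clockwise normal at some angle within `π` of a prescribed one. -/
lemma exists_angle_near {v₀ v₁ : ℝ} (hv : v₀ ^ 2 + v₁ ^ 2 = 1) (θ₀ : ℝ) :
    ∃ β, |β - θ₀| ≤ Real.pi ∧ v₀ = Real.sin β ∧ v₁ = -Real.cos β := by
  set z : ℂ := ⟨-v₁, v₀⟩ * ⟨Real.cos θ₀, -Real.sin θ₀⟩ with hz
  have hre : z.re = -v₁ * Real.cos θ₀ + v₀ * Real.sin θ₀ := by simp [hz, Complex.mul_re]
  have him : z.im = v₁ * Real.sin θ₀ + v₀ * Real.cos θ₀ := by simp [hz, Complex.mul_im]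
  have h4 := Real.sin_sq_add_cos_sq θ₀
  have hn : ‖z‖ = 1 := by
    rw [Complex.norm_def, Complex.normSq_apply, hre, him, Real.sqrt_eq_one]
    linear_combination (Real.sin θ₀ ^ 2 + Real.cos θ₀ ^ 2) * hv + h4
  have hz0 : z ≠ 0 := by rw [← norm_ne_zero_iff, hn]; exact one_ne_zero
  refine ⟨θ₀ + Complex.arg z, ?_, ?_, ?_⟩
  · rw [add_sub_cancel_left]; exact Complex.abs_arg_le_pi z
  · rw [Real.sin_add, Complex.cos_arg hz0, Complex.sin_arg, hn, hre, him]
    linear_combination -v₀ * h4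
  · rw [Real.cos_add, Complex.cos_arg hz0, Complex.sin_arg, hn, hre, him]
    linear_combination -v₁ * h4

/-- A function on `ℝ` whose derivative is bounded below by a positive constant is surjective. -/
lemma surjective_of_le_deriv {θ κ : ℝ → ℝ} {m : ℝ} (hm : 0 < m)
    (hθ : ∀ t, HasDerivAt θ (κ t) t) (hκ : ∀ t, m ≤ κ t) : Function.Surjective θ := by
  have hmono : Monotone fun t => θ t - m * t :=
    monotone_of_hasDerivAt_nonneg
      (fun t => (hθ t).sub ((hasDerivAt_id t).const_mul m))
      (fun t => by simpa using hκ t)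
  have hcont : Continuous θ := continuous_iff_continuousAt.2 fun t => (hθ t).continuousAt
  refine hcont.surjective ?_ ?_
  · refine Filter.tendsto_atTop_mono' _ ?_
      (Filter.tendsto_atTop_add_const_left _ (θ 0) (Filter.tendsto_id.const_mul_atTop hm))
    filter_upwards [Filter.eventually_ge_atTop 0] with t ht
    have := hmono ht
    simp only [mul_zero, id] at this ⊢
    linarith
  · refine Filter.tendsto_atBot_mono' _ ?_
      (Filter.tendsto_atBot_add_const_left _ (θ 0) (Filter.tendsto_id.const_mul_atBot hm))
    filter_upwards [Filter.eventually_le_atBot 0] with t ht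
    have := hmono ht
    simp only [mul_zero, id] at this ⊢
    linarith

/-- If `F' = (1 - r κ) sin (θ s - θ)` with `θ' = κ ≥ 1 / r` and the angles at `s₀` and `s` differ
by at most `π`, then `F s ≤ F s₀`. -/
lemma le_of_hasDerivAt_sin {F θ κ : ℝ → ℝ} {r s₀ s : ℝ}
    (hθ : ∀ t, HasDerivAt θ (κ t) t) (hκ : ∀ t, 0 ≤ κ t) (hr : ∀ t, 1 ≤ r * κ t)
    (hF : ∀ t, HasDerivAt F ((1 - r * κ t) * Real.sin (θ s - θ t)) t)
    (hπ : |θ s - θ s₀| ≤ Real.pi) : F s ≤ F s₀ := by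
  have hmono : Monotone θ := monotone_of_hasDerivAt_nonneg hθ hκ
  have hcont : Continuous F := continuous_iff_continuousAt.2 fun t => (hF t).continuousAt
  rw [abs_le] at hπ
  rcases le_total s₀ s with h | h
  · refine antitoneOn_of_hasDerivWithinAt_nonpos (convex_Icc s₀ s) hcont.continuousOn
      (fun t _ => (hF t).hasDerivWithinAt) (fun t ht => ?_)
      (Set.left_mem_Icc.2 h) (Set.right_mem_Icc.2 h) h
    rw [interior_Icc] at ht
    refine mul_nonpos_of_nonpos_of_nonneg (by linarith [hr t]) ?_
    exact Real.sin_nonneg_of_nonneg_of_le_pi (by linarith [hmono ht.2.le])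
      (by linarith [hmono ht.1.le])
  · refine monotoneOn_of_hasDerivWithinAt_nonneg (convex_Icc s s₀) hcont.continuousOn
      (fun t _ => (hF t).hasDerivWithinAt) (fun t ht => ?_)
      (Set.left_mem_Icc.2 h) (Set.right_mem_Icc.2 h) h
    rw [interior_Icc] at ht
    refine mul_nonneg_of_nonpos_of_nonpos (by linarith [hr t]) ?_
    exact Real.sin_nonpos_of_nonpos_of_neg_pi_le (by linarith [hmono ht.1.le])
      (by linarith [hmono ht.2.le])

/-- The support function identity, given that `K` lies in the ball of radius `r` whose boundary
passes through a support point `p` of `K` with outer normal `u` there. -/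
lemma sSup_inner_add_sSup_inner_neg {E : Type*} [NormedAddCommGroup E] [InnerProductSpace ℝ E]
    {K : Set E} {u p : E} {r : ℝ} (hu : ‖u‖ = 1) (hp : p ∈ K)
    (hmax : ∀ x ∈ K, ⟪x, u⟫ ≤ ⟪p, u⟫) (hball : K ⊆ closedBall (p - r • u) r) :
    sSup ((fun y => ⟪y, u⟫) '' K) +
      sSup ((fun y => ⟪y, -u⟫) '' {x | K ⊆ closedBall x r}) = r := by
  have h1 : IsGreatest ((fun y => ⟪y, u⟫) '' K) ⟪p, u⟫ :=
    ⟨⟨p, hp, rfl⟩, by rintro _ ⟨x, hx, rfl⟩; exact hmax x hx⟩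
  have h2 : IsGreatest ((fun y => ⟪y, -u⟫) '' {x | K ⊆ closedBall x r}) (r - ⟪p, u⟫) := by
    constructor
    · refine ⟨p - r • u, hball, ?_⟩
      simp only [inner_neg_right, inner_sub_left, real_inner_smul_left,
        real_inner_self_eq_norm_sq, hu]
      ring
    · rintro _ ⟨x, hx, rfl⟩
      have h3 : ‖p - x‖ ≤ r := mem_closedBall_iff_norm.1 (hx hp)
      have h4 := real_inner_le_norm (p - x) u
      rw [hu, mul_one, inner_sub_left] at h4
      simp only [inner_neg_right]
      linarith
  rw [h1.csSup_eq, h2.csSup_eq]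
  ring

lemma EuclideanSpace.inner_fin_two (x y : EuclideanSpace ℝ (Fin 2)) :
    ⟪x, y⟫ = x 0 * y 0 + x 1 * y 1 := by
  simp [PiLp.inner_apply, Fin.sum_univ_two, mul_comm]

lemma EuclideanSpace.norm_sq_fin_two (x : EuclideanSpace ℝ (Fin 2)) :
    ‖x‖ ^ 2 = x 0 ^ 2 + x 1 ^ 2 := by
  rw [← real_inner_self_eq_norm_sq, EuclideanSpace.inner_fin_two]
  ring

/-- For a planar convex body `K` with `C²` boundary and curvature `κ ≥ κₘ > 0`, and
`r > 1/κₘ`, the `r`-dual body `K^{*,r} = {x : K ⊆ rB² + x}` satisfies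
`h_K(u) + h_{K^{*,r}}(-u) = r` for every unit vector `u`, where `h_L` is the support
function. -/
theorem support_function_of_r_dual
    (K : Set (EuclideanSpace ℝ (Fin 2)))
    (hKcomp : IsCompact K) (hKconv : Convex ℝ K) (hKint : (interior K).Nonempty)
    (γ : ℝ → EuclideanSpace ℝ (Fin 2)) (hγ : ContDiff ℝ 2 γ)
    (hγspeed : ∀ s, ‖deriv γ s‖ = 1)
    (hγrange : frontier K = Set.range γ)
    (κ : ℝ → ℝ)
    (hκdef : ∀ s, κ s =
      deriv γ s 0 * deriv (deriv γ) s 1 - deriv γ s 1 * deriv (deriv γ) s 0)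
    (κm : ℝ) (hκm : 0 < κm) (hκ : ∀ s, κm ≤ κ s)
    (r : ℝ) (hr : 1 / κm < r) :
    ∀ u : EuclideanSpace ℝ (Fin 2), ‖u‖ = 1 →
      sSup ((fun y => ⟪y, u⟫) '' K) +
        sSup ((fun y => ⟪y, -u⟫) '' {x | K ⊆ closedBall x r}) = r := by
  intro u hu
  have hγ2 : ContDiff ℝ 1 (deriv γ) := ((contDiff_succ_iff_deriv (n := 1)).1 hγ).2.2
  have hd1 : ∀ i t, HasDerivAt (fun t => γ t i) (deriv γ t i) t := fun i t =>
    (EuclideanSpace.proj (𝕜 := ℝ) i).hasFDerivAt.comp_hasDerivAt t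
      (hγ.differentiable (by norm_num) t).hasDerivAt
  have hd2 : ∀ i t, HasDerivAt (fun t => deriv γ t i) (deriv (deriv γ) t i) t := fun i t =>
    (EuclideanSpace.proj (𝕜 := ℝ) i).hasFDerivAt.comp_hasDerivAt t
      (hγ2.differentiable (by norm_num) t).hasDerivAt
  have hab : ∀ t, deriv γ t 0 ^ 2 + deriv γ t 1 ^ 2 = 1 := fun t => by
    rw [← EuclideanSpace.norm_sq_fin_two, hγspeed, one_pow]
  have horth : ∀ t, deriv γ t 0 * deriv (deriv γ) t 0 + deriv γ t 1 * deriv (deriv γ) t 1 = 0 := by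
    intro t
    have h := ((hd2 0 t).pow 2).add ((hd2 1 t).pow 2)
    have h' := h.unique ((hasDerivAt_const t (1 : ℝ)).congr_of_eventuallyEq
      (Filter.Eventually.of_forall hab))
    norm_num at h'
    linarith
  have ha : ∀ t, HasDerivAt (fun t => deriv γ t 0) (-(κ t * deriv γ t 1)) t := fun t => by
    refine (hd2 0 t).congr_deriv ?_
    rw [hκdef]
    linear_combination deriv γ t 0 * horth t - deriv (deriv γ) t 0 * hab t
  have hb : ∀ t, HasDerivAt (fun t => deriv γ t 1) (κ t * deriv γ t 0) t := fun t => by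
    refine (hd2 1 t).congr_deriv ?_
    rw [hκdef]
    linear_combination deriv γ t 1 * horth t - deriv (deriv γ) t 1 * hab t
  have hκcont : Continuous κ := by
    have h1 : Continuous (deriv γ) := hγ2.continuous
    have h2 : Continuous (deriv (deriv γ)) := hγ2.continuous_deriv le_rfl
    rw [funext hκdef]
    fun_prop
  obtain ⟨θ, hθ, hθab⟩ := exists_angle_s8 hκcont ha hb hab
  have hκpos : ∀ t, 0 < κ t := fun t => hκm.trans_le (hκ t)
  have hrκ : ∀ t, 1 ≤ r * κ t := fun t => by
    have h1 : 1 < r * κm := (div_lt_iff₀ hκm).1 hr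
    have hr0 : 0 < r := (one_div_pos.2 hκm).trans hr
    exact h1.le.trans (mul_le_mul_of_nonneg_left (hκ t) hr0.le)
  have hx : ∀ t, HasDerivAt (fun t => γ t 0) (Real.cos (θ t)) t := fun t =>
    (hθab t).1 ▸ hd1 0 t
  have hy : ∀ t, HasDerivAt (fun t => γ t 1) (Real.sin (θ t)) t := fun t =>
    (hθab t).2 ▸ hd1 1 t
  have hγK : ∀ t, γ t ∈ K := fun t =>
    hKcomp.isClosed.frontier_subset (hγrange ▸ Set.mem_range_self t)
  have hnormal : ∀ s (v : EuclideanSpace ℝ (Fin 2)), ‖v‖ = 1 →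
      (∀ x ∈ K, ⟪x, v⟫ ≤ ⟪γ s, v⟫) → v 0 = Real.sin (θ s) ∧ v 1 = -Real.cos (θ s) := by
    intro s v hv hmax
    have hg : ∀ t, HasDerivAt (fun t => ⟪γ t, v⟫)
        (Real.cos (θ t) * v 0 + Real.sin (θ t) * v 1) t := fun t => by
      simp only [EuclideanSpace.inner_fin_two]
      exact ((hx t).mul_const _).add ((hy t).mul_const _)
    have hg' := ((hθ s).cos.mul_const (v 0)).add ((hθ s).sin.mul_const (v 1))
    have hloc : IsLocalMax (fun t => ⟪γ t, v⟫) s :=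
      Filter.Eventually.of_forall fun t => hmax _ (hγK t)
    have h1 := hloc.hasDerivAt_eq_zero (hg s)
    have h2 := hloc.second_deriv_nonpos hg hg'
    have h3 := EuclideanSpace.norm_sq_fin_two v
    have h4 := Real.sin_sq_add_cos_sq (θ s)
    rw [hv] at h3
    set l := Real.sin (θ s) * v 0 - Real.cos (θ s) * v 1 with hl
    have h5 : 0 ≤ l := by
      have : 0 ≤ κ s * l := by rw [hl]; linarith
      exact nonneg_of_mul_nonneg_right this (hκpos s)
    have h6 : l ^ 2 = 1 := by
      rw [hl]
      linear_combination -(Real.cos (θ s) * v 0 + Real.sin (θ s) * v 1) * h1 - h3 +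
        (v 0 ^ 2 + v 1 ^ 2) * h4
    have h7 : l = 1 := by nlinarith
    rw [hl] at h7
    constructor
    · linear_combination Real.cos (θ s) * h1 + Real.sin (θ s) * h7 - v 0 * h4
    · linear_combination Real.sin (θ s) * h1 - Real.cos (θ s) * h7 - v 1 * h4
  have hsupport : ∀ s (v : EuclideanSpace ℝ (Fin 2)), v 0 = Real.sin (θ s) →
      v 1 = -Real.cos (θ s) → ∀ x ∈ K, ⟪x, v⟫ ≤ ⟪γ s, v⟫ := by
    intro s v hv0 hv1
    obtain ⟨w, hw, hwmax⟩ := exists_unit_normal hKconv hKint (hγrange ▸ Set.mem_range_self s)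
    obtain ⟨hw0, hw1⟩ := hnormal s w hw hwmax
    have : v = w := by
      ext i
      fin_cases i
      · exact hv0.trans hw0.symm
      · exact hv1.trans hw1.symm
    rwa [this]
  obtain ⟨p, hpK, hpmax⟩ := hKcomp.exists_isMaxOn (hKint.mono interior_subset)
    (f := fun y => ⟪y, u⟫) (by fun_prop)
  have hpf : p ∈ frontier K :=
    mem_frontier_of_forall_inner_le (norm_ne_zero_iff.1 (by rw [hu]; exact one_ne_zero)) hpK hpmax
  obtain ⟨s₀, rfl⟩ : p ∈ Set.range γ := hγrange ▸ hpf
  obtain ⟨hu0, hu1⟩ := hnormal s₀ u hu hpmax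
  refine sSup_inner_add_sSup_inner_neg hu hpK hpmax fun x hxK => ?_
  set c := γ s₀ - r • u with hc
  rw [mem_closedBall_iff_norm]
  by_contra! hlt
  have hpos : 0 < ‖x - c‖ := ((one_div_pos.2 hκm).trans hr).trans hlt
  set v := ‖x - c‖⁻¹ • (x - c) with hv_def
  have hv : ‖v‖ = 1 := norm_smul_inv_norm (norm_pos_iff.1 hpos)
  have hxv : ⟪x - c, v⟫ = ‖x - c‖ := by
    rw [hv_def, real_inner_smul_right, real_inner_self_eq_norm_sq]
    field_simp
  have hv2 := EuclideanSpace.norm_sq_fin_two v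
  rw [hv, one_pow] at hv2
  obtain ⟨β, hβ, hv0, hv1⟩ := exists_angle_near hv2.symm (θ s₀)
  obtain ⟨s, rfl⟩ := surjective_of_le_deriv hκm hθ hκ β
  have hF : ∀ t, HasDerivAt (fun t => γ t 0 * v 0 + γ t 1 * v 1 -
      r * (Real.sin (θ t) * v 0 + -Real.cos (θ t) * v 1))
      ((1 - r * κ t) * Real.sin (θ s - θ t)) t := fun t => by
    refine ((((hx t).mul_const _).add ((hy t).mul_const _)).sub
      ((((hθ t).sin.mul_const _).add ((hθ t).cos.neg.mul_const _)).const_mul r)).congr_deriv ?_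
    rw [Real.sin_sub, hv0, hv1]
    ring
  have hle := le_of_hasDerivAt_sin hθ (fun t => (hκpos t).le) hrκ hF hβ
  have hs := hsupport s v hv0 hv1 x hxK
  simp only [← hu0, ← hu1, ← hv0, ← hv1] at hle
  rw [hc, inner_sub_left, inner_sub_left, real_inner_smul_left] at hxv
  simp only [EuclideanSpace.inner_fin_two] at hxv hs
  have hvv : v 0 * v 0 + v 1 * v 1 = 1 := by linarith
  rw [hvv] at hle
  linarith
end

section
/- Let K ⊂ ℝ² be a convex body with C² boundary and minimal curvature κ_m, and let r > 1/κ_m. Then the r-dual K^{*,r} has C² boundary and for every u ∈ S¹: 1/κ_K(x(K,u)) + 1/κ_{K^{*,r}}(x(K^{*,r},−u)) = r, where x(L,u) is the unique boundary point of L with outer unit normal u and κ_L denotes curvature. -/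
open Metric
open scoped RealInnerProductSpace

/-- The Euclidean plane. -/
abbrev Plane := EuclideanSpace ℝ (Fin 2)

/-- The unit vector at angle `θ`. -/
noncomputable def normalDir (θ : ℝ) : Plane := !₂[Real.cos θ, Real.sin θ]

/-- The unit vector at angle `θ + π / 2`. -/
noncomputable def tangentDir (θ : ℝ) : Plane := !₂[-Real.sin θ, Real.cos θ]

@[simp] lemma normalDir_apply_zero (θ : ℝ) : normalDir θ 0 = Real.cos θ := by simp [normalDir]

@[simp] lemma normalDir_apply_one (θ : ℝ) : normalDir θ 1 = Real.sin θ := by simp [normalDir]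

@[simp] lemma tangentDir_apply_zero (θ : ℝ) : tangentDir θ 0 = -Real.sin θ := by simp [tangentDir]

@[simp] lemma tangentDir_apply_one (θ : ℝ) : tangentDir θ 1 = Real.cos θ := by simp [tangentDir]

lemma plane_ext {x y : Plane} (h₀ : x 0 = y 0) (h₁ : x 1 = y 1) : x = y := by
  ext i
  fin_cases i
  · exact h₀
  · exact h₁

lemma inner_plane (x y : Plane) : ⟪x, y⟫ = x 0 * y 0 + x 1 * y 1 := by
  simp [PiLp.inner_apply, Fin.sum_univ_two, mul_comm]

lemma norm_sq_plane (x : Plane) : ‖x‖ ^ 2 = x 0 ^ 2 + x 1 ^ 2 := by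
  simp [EuclideanSpace.real_norm_sq_eq, Fin.sum_univ_two]

lemma norm_eq_one_iff_plane (x : Plane) : ‖x‖ = 1 ↔ x 0 ^ 2 + x 1 ^ 2 = 1 := by
  rw [← norm_sq_plane, pow_eq_one_iff_of_nonneg (norm_nonneg x) two_ne_zero]

lemma norm_normalDir (θ : ℝ) : ‖normalDir θ‖ = 1 := by
  simp [norm_eq_one_iff_plane]

lemma norm_tangentDir (θ : ℝ) : ‖tangentDir θ‖ = 1 := by
  simp [norm_eq_one_iff_plane]

lemma hasDerivAt_plane {f : ℝ → Plane} {f' : Plane} {t : ℝ}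
    (h₀ : HasDerivAt (fun x => f x 0) (f' 0) t) (h₁ : HasDerivAt (fun x => f x 1) (f' 1) t) :
    HasDerivAt f f' t := by
  rw [hasDerivAt_iff_hasFDerivAt, ← hasFDerivWithinAt_univ, hasFDerivWithinAt_euclidean]
  simp only [hasFDerivWithinAt_univ]
  intro i
  fin_cases i
  · convert! h₀.hasFDerivAt using 1
  · convert! h₁.hasFDerivAt using 1

lemma HasDerivAt.plane_apply {f : ℝ → Plane} {f' : Plane} {t : ℝ} (h : HasDerivAt f f' t)
    (i : Fin 2) : HasDerivAt (fun x => f x i) (f' i) t := by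
  have := (hasFDerivWithinAt_euclidean.1 (h.hasFDerivAt.hasFDerivWithinAt (s := Set.univ)) i).hasDerivWithinAt
  simpa using this.hasDerivAt Filter.univ_mem

lemma hasDerivAt_normalDir (θ : ℝ) : HasDerivAt normalDir (tangentDir θ) θ :=
  hasDerivAt_plane (by simpa using Real.hasDerivAt_cos θ) (by simpa using Real.hasDerivAt_sin θ)

lemma hasDerivAt_tangentDir (θ : ℝ) : HasDerivAt tangentDir (-normalDir θ) θ :=
  hasDerivAt_plane (by simpa using (Real.hasDerivAt_sin θ).fun_neg)
    (by simpa using Real.hasDerivAt_cos θ)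

lemma inner_tangentDir_normalDir (t θ : ℝ) :
    ⟪tangentDir t, normalDir θ⟫ = Real.sin (θ - t) := by
  simp [inner_plane, Real.sin_sub]; ring

lemma eq_zero_of_inner_dirs {x : Plane} {θ : ℝ} (hn : ⟪x, normalDir θ⟫ = 0)
    (ht : ⟪x, tangentDir θ⟫ = 0) : x = 0 := by
  simp only [inner_plane, normalDir_apply_zero, normalDir_apply_one, tangentDir_apply_zero,
    tangentDir_apply_one] at hn ht
  have h := Real.sin_sq_add_cos_sq θ
  refine plane_ext ?_ ?_ <;> simp only [PiLp.zero_apply]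
  · linear_combination Real.cos θ * hn - Real.sin θ * ht - x 0 * h
  · linear_combination Real.sin θ * hn + Real.cos θ * ht - x 1 * h

lemma exists_normalDir_smul (x : Plane) : ∃ θ, x = ‖x‖ • normalDir θ := by
  let z : ℂ := ⟨x 0, x 1⟩
  have hz : ‖z‖ = ‖x‖ := by
    rw [← sq_eq_sq₀ (norm_nonneg _) (norm_nonneg _), norm_sq_plane, Complex.sq_norm,
      Complex.normSq_apply]
    ring
  refine ⟨Complex.arg z, plane_ext ?_ ?_⟩
  · simp [← hz, z]
  · simp [← hz, z]

/-- A function with continuous derivative bounded below by a positive constant is a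
diffeomorphism of the line. -/
lemma exists_inverse_of_le_deriv {f f' : ℝ → ℝ} (hf : ∀ x, HasDerivAt f (f' x) x) {c : ℝ}
    (hc : 0 < c) (hf' : ∀ x, c ≤ f' x) :
    ∃ g : ℝ → ℝ, (∀ x, g (f x) = x) ∧ (∀ y, f (g y) = y) ∧
      ∀ y, HasDerivAt g (f' (g y))⁻¹ y := by
  have hdiff : Differentiable ℝ f := fun x => (hf x).differentiableAt
  have hmono : StrictMono f := strictMono_of_deriv_pos fun x => by
    rw [(hf x).deriv]; exact hc.trans_le (hf' x)
  have hgrowth : ∀ x y, x ≤ y → c * (y - x) ≤ f y - f x := fun x y hxy =>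
    mul_sub_le_image_sub_of_le_deriv hdiff (fun x => by rw [(hf x).deriv]; exact hf' x) hxy
  have hsurj : Function.Surjective f := by
    refine hdiff.continuous.surjective ?_ ?_
    · refine Filter.tendsto_atTop_mono' _ ((Filter.eventually_ge_atTop 0).mono fun x hx => ?_)
        (Filter.tendsto_atTop_add_const_left _ (f 0) (Filter.tendsto_id.const_mul_atTop hc))
      have := hgrowth 0 x hx
      simp only [id]; linarith
    · refine Filter.tendsto_atBot_mono' _ ((Filter.eventually_le_atBot 0).mono fun x hx => ?_)
        (Filter.tendsto_atBot_add_const_left _ (f 0) (Filter.tendsto_id.const_mul_atBot hc))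
      have := hgrowth x 0 hx
      simp only [id]; linarith
  let e := StrictMono.orderIsoOfSurjective f hmono hsurj
  have he : ∀ y, f (e.symm y) = y := fun y => e.apply_symm_apply y
  refine ⟨e.symm, fun x => e.symm_apply_apply x, he, fun y => ?_⟩
  exact (hf _).of_local_left_inverse e.symm.continuous.continuousAt
    (hc.trans_le (hf' _)).ne' (Filter.Eventually.of_forall he)

lemma exists_antideriv {f : ℝ → ℝ} (hf : Continuous f) (a : ℝ) :
    ∃ F : ℝ → ℝ, F 0 = a ∧ ∀ x, HasDerivAt F (f x) x :=
  ⟨fun x => a + ∫ t in (0 : ℝ)..x, f t, by simp,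
    fun x => ((hf.integral_hasStrictDerivAt 0 x).hasDerivAt).const_add a⟩

/-- A vector exposing a point of a curve parametrized by its tangent angle is a positive multiple
of the normal direction there. -/
lemma exists_pos_smul_normalDir {c : ℝ → Plane} {σ : ℝ → ℝ} (hσ : ∀ t, 0 < σ t)
    (hc : ∀ t, HasDerivAt c (σ t • tangentDir t) t) {θ : ℝ} {v : Plane} (hv : v ≠ 0)
    (hmax : ∀ t, ⟪c t, v⟫ ≤ ⟪c θ, v⟫) : ∃ a : ℝ, 0 < a ∧ v = a • normalDir θ := by
  have hd : ∀ t, HasDerivAt (fun t => ⟪c t, v⟫) (σ t * ⟪tangentDir t, v⟫) t := fun t => by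
    simpa [real_inner_smul_left] using (hc t).inner ℝ (hasDerivAt_const t v)
  have h₀ : ⟪tangentDir θ, v⟫ = 0 := by
    have hloc : IsLocalMax (fun t => ⟪c t, v⟫) θ := Filter.Eventually.of_forall hmax
    exact (mul_eq_zero.1 (hloc.hasDerivAt_eq_zero (hd θ))).resolve_left (hσ θ).ne'
  set a : ℝ := ⟪v, normalDir θ⟫ with ha
  have hva : v = a • normalDir θ := by
    refine sub_eq_zero.1 (eq_zero_of_inner_dirs (θ := θ) ?_ ?_)
    · rw [inner_sub_left, real_inner_smul_left, real_inner_self_eq_norm_sq, norm_normalDir]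
      simp [ha]
    · rw [inner_sub_left, real_inner_smul_left, real_inner_comm, h₀, real_inner_comm,
        inner_tangentDir_normalDir]
      simp
  refine ⟨a, lt_of_not_ge fun hle => ?_, hva⟩
  have hneg : a < 0 := lt_of_le_of_ne hle fun h => hv (by rw [hva, h, zero_smul])
  have hmono : StrictMonoOn (fun t => ⟪c t, v⟫) (Set.Icc θ (θ + Real.pi)) := by
    refine strictMonoOn_of_deriv_pos (convex_Icc _ _)
      (fun t _ => (hd t).continuousAt.continuousWithinAt) fun t ht => ?_
    rw [interior_Icc] at ht
    rw [(hd t).deriv, hva, real_inner_smul_right, inner_tangentDir_normalDir]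
    refine mul_pos (hσ t) (mul_pos_of_neg_of_neg hneg ?_)
    exact Real.sin_neg_of_neg_of_neg_pi_lt (by linarith [ht.1]) (by linarith [ht.2])
  have := hmono (Set.left_mem_Icc.2 (by linarith [Real.pi_pos]))
    (Set.right_mem_Icc.2 (by linarith [Real.pi_pos])) (by linarith [Real.pi_pos])
  exact absurd (hmax (θ + Real.pi)) (not_le.2 this)

lemma eq_normalDir_of_inner_le {c : ℝ → Plane} {σ : ℝ → ℝ} (hσ : ∀ t, 0 < σ t)
    (hc : ∀ t, HasDerivAt c (σ t • tangentDir t) t) {θ : ℝ} {v : Plane} (hv : ‖v‖ = 1)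
    (hmax : ∀ t, ⟪c t, v⟫ ≤ ⟪c θ, v⟫) : v = normalDir θ := by
  obtain ⟨a, ha, h⟩ := exists_pos_smul_normalDir hσ hc (norm_ne_zero_iff.1 (by simp [hv])) hmax
  rw [h, norm_smul, norm_normalDir, mul_one, Real.norm_of_nonneg ha.le] at hv
  rw [h, hv, one_smul]

/-- A closed curve parametrized by its tangent angle lies in each of its tangent half-planes. -/
lemma inner_normalDir_le {c : ℝ → Plane} {σ : ℝ → ℝ} (hσ : ∀ t, 0 < σ t)
    (hc : ∀ t, HasDerivAt c (σ t • tangentDir t) t) (hper : Function.Periodic c (2 * Real.pi))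
    (θ t : ℝ) : ⟪c t, normalDir θ⟫ ≤ ⟪c θ, normalDir θ⟫ := by
  have hd : ∀ t, HasDerivAt (fun t => ⟪c t, normalDir θ⟫) (σ t * Real.sin (θ - t)) t := fun t => by
    simpa [real_inner_smul_left, inner_tangentDir_normalDir] using
      (hc t).inner ℝ (hasDerivAt_const t (normalDir θ))
  have hcont : ∀ s, ContinuousOn (fun t => ⟪c t, normalDir θ⟫) s :=
    fun s t _ => (hd t).continuousAt.continuousWithinAt
  have hdiff : ∀ s, DifferentiableOn ℝ (fun t => ⟪c t, normalDir θ⟫) s :=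
    fun s t _ => (hd t).differentiableAt.differentiableWithinAt
  obtain ⟨t', ht', heq⟩ := hper.exists_mem_Ico (by positivity) t (θ - Real.pi)
  rw [heq]
  rcases le_total t' θ with h | h
  · have hmono : MonotoneOn (fun t => ⟪c t, normalDir θ⟫) (Set.Icc (θ - Real.pi) θ) := by
      refine monotoneOn_of_deriv_nonneg (convex_Icc _ _) (hcont _) (hdiff _) fun x hx => ?_
      rw [interior_Icc] at hx
      rw [(hd x).deriv]
      exact mul_nonneg (hσ x).le
        (Real.sin_nonneg_of_nonneg_of_le_pi (by linarith [hx.2]) (by linarith [hx.1]))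
    exact hmono ⟨ht'.1, h⟩ (Set.right_mem_Icc.2 (by linarith [Real.pi_pos])) h
  · have hanti : AntitoneOn (fun t => ⟪c t, normalDir θ⟫) (Set.Icc θ (θ + Real.pi)) := by
      refine antitoneOn_of_deriv_nonpos (convex_Icc _ _) (hcont _) (hdiff _) fun x hx => ?_
      rw [interior_Icc] at hx
      rw [(hd x).deriv]
      exact mul_nonpos_of_nonneg_of_nonpos (hσ x).le
        (Real.sin_nonpos_of_nonpos_of_neg_pi_le (by linarith [hx.1]) (by linarith [hx.2]))
    exact hanti (Set.left_mem_Icc.2 (by linarith [Real.pi_pos])) ⟨h, by linarith [ht'.2]⟩ h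

lemma normalDir_periodic : Function.Periodic normalDir (2 * Real.pi) := fun θ =>
  plane_ext (by simp) (by simp)

lemma tangentDir_periodic : Function.Periodic tangentDir (2 * Real.pi) := fun θ =>
  plane_ext (by simp) (by simp)

/-- A curve parametrized by its normal angle and lying in each of its tangent half-planes is
closed. -/
lemma periodic_of_inner_normalDir_le {c : ℝ → Plane} {σ : ℝ → ℝ}
    (hc : ∀ t, HasDerivAt c (σ t • tangentDir t) t)
    (hle : ∀ θ t, ⟪c t, normalDir θ⟫ ≤ ⟪c θ, normalDir θ⟫) :
    Function.Periodic c (2 * Real.pi) := by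
  have hd : ∀ t, HasDerivAt (fun t => ⟪c t, normalDir t⟫) ⟪c t, tangentDir t⟫ t := fun t => by
    simpa [real_inner_smul_left, inner_tangentDir_normalDir] using
      (hc t).inner ℝ (hasDerivAt_normalDir t)
  have hsupp : ∀ t, ⟪c (t + 2 * Real.pi), normalDir t⟫ = ⟪c t, normalDir t⟫ := fun t => by
    refine le_antisymm (hle _ _) ?_
    simpa only [normalDir_periodic t] using hle (t + 2 * Real.pi) t
  intro t
  refine sub_eq_zero.1 (eq_zero_of_inner_dirs (θ := t) ?_ ?_)
  · rw [inner_sub_left, hsupp, sub_self]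
  · have h₁ := (hd (t + 2 * Real.pi)).comp_add_const t (2 * Real.pi)
    simp only [normalDir_periodic _, tangentDir_periodic _, hsupp] at h₁
    rw [inner_sub_left, h₁.unique (hd t), sub_self]

lemma periodic_speed {c : ℝ → Plane} {σ : ℝ → ℝ}
    (hc : ∀ t, HasDerivAt c (σ t • tangentDir t) t) (hper : Function.Periodic c (2 * Real.pi)) :
    Function.Periodic σ (2 * Real.pi) := by
  intro t
  have h₁ := (hc (t + 2 * Real.pi)).comp_add_const t (2 * Real.pi)
  simp only [hper _, tangentDir_periodic _] at h₁
  exact smul_left_injective ℝ (norm_ne_zero_iff.1 (by simp [norm_tangentDir])) (h₁.unique (hc t))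

lemma apply_eq_of_normalDir_eq {σ : ℝ → ℝ} (hσ : Function.Periodic σ (2 * Real.pi)) {θ φ : ℝ}
    (h : normalDir θ = normalDir φ) : σ θ = σ φ := by
  have h₀ := congrArg (fun x : Plane => x 0) h
  have h₁ := congrArg (fun x : Plane => x 1) h
  simp only [normalDir_apply_zero, normalDir_apply_one] at h₀ h₁
  obtain ⟨k, hk⟩ := Real.Angle.angle_eq_iff_two_pi_dvd_sub.1 (Real.Angle.cos_sin_inj h₀ h₁)
  have : θ = φ + k * (2 * Real.pi) := by linear_combination hk
  rw [this]
  exact hσ.int_mul k φ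

/-- The frontier of an intersection of half-planes whose bounding lines envelop a closed curve
lying in all of the half-planes. -/
lemma frontier_setOf_inner_le {c : ℝ → Plane} {σ : ℝ → ℝ}
    (hc : ∀ t, HasDerivAt c (σ t • tangentDir t) t) (hper : Function.Periodic c (2 * Real.pi))
    (hle : ∀ θ t, ⟪c t, normalDir θ⟫ ≤ ⟪c θ, normalDir θ⟫) :
    frontier {x : Plane | ∀ θ, ⟪x, normalDir θ⟫ ≤ ⟪c θ, normalDir θ⟫} = Set.range c := by
  set L : Set Plane := {x | ∀ θ, ⟪x, normalDir θ⟫ ≤ ⟪c θ, normalDir θ⟫} with hL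
  have hclosed : IsClosed L := by
    rw [hL, Set.ofPred_forall]
    exact isClosed_iInter fun θ => isClosed_le (by fun_prop) continuous_const
  rw [hclosed.frontier_eq]
  ext x
  constructor
  · rintro ⟨hx, hxi⟩
    have hd : ∀ t, HasDerivAt (fun t => ⟪c t - x, normalDir t⟫) ⟪c t - x, tangentDir t⟫ t :=
      fun t => by
        simpa [real_inner_smul_left, inner_tangentDir_normalDir] using
          ((hc t).sub_const x).inner ℝ (hasDerivAt_normalDir t)
    have hcont : Continuous fun t => ⟪c t - x, normalDir t⟫ :=
      continuous_iff_continuousAt.2 fun t => (hd t).continuousAt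
    obtain ⟨θ, -, hθ⟩ := isCompact_Icc.exists_isMinOn (s := Set.Icc 0 (2 * Real.pi))
      (Set.nonempty_Icc.2 (by positivity)) hcont.continuousOn
    have hmin : ∀ t, ⟪c θ - x, normalDir θ⟫ ≤ ⟪c t - x, normalDir t⟫ := fun t => by
      have hp : Function.Periodic (fun t => ⟪c t - x, normalDir t⟫) (2 * Real.pi) := fun t => by
        simp only [hper t, normalDir_periodic t]
      obtain ⟨t', ht', heq⟩ := hp.exists_mem_Ico₀ (by positivity) t
      rw [heq]
      exact hθ ⟨ht'.1, ht'.2.le⟩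
    have hzero : ⟪c θ - x, normalDir θ⟫ = 0 := by
      refine le_antisymm (le_of_not_gt fun hpos => hxi ?_) ?_
      · refine mem_interior.2 ⟨ball x ⟪c θ - x, normalDir θ⟫, fun y hy t => ?_, isOpen_ball,
          mem_ball_self hpos⟩
        have h₁ : ⟪y - x, normalDir t⟫ ≤ ‖y - x‖ := by
          simpa [norm_normalDir] using real_inner_le_norm (y - x) (normalDir t)
        rw [mem_ball, dist_eq_norm] at hy
        have h₂ := hmin t
        rw [inner_sub_left] at h₁
        rw [inner_sub_left (c t)] at h₂
        linarith
      · rw [inner_sub_left]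
        linarith [hx θ]
    have hloc : IsLocalMin (fun t => ⟪c t - x, normalDir t⟫) θ := Filter.Eventually.of_forall hmin
    exact ⟨θ, sub_eq_zero.1 (eq_zero_of_inner_dirs hzero (hloc.hasDerivAt_eq_zero (hd θ)))⟩
  · rintro ⟨φ, rfl⟩
    refine ⟨fun θ => hle θ φ, fun hi => ?_⟩
    obtain ⟨ε, hε, hball⟩ := Metric.isOpen_iff.1 isOpen_interior _ hi
    have hmem : c φ + (ε / 2) • normalDir φ ∈ L := interior_subset <| hball <| by
      rw [mem_ball, dist_eq_norm, add_sub_cancel_left, norm_smul, norm_normalDir, mul_one,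
        Real.norm_of_nonneg (by positivity)]
      linarith
    have := hmem φ
    rw [inner_add_left, real_inner_smul_left, real_inner_self_eq_norm_sq, norm_normalDir] at this
    linarith

lemma subset_closedBall_iff {K : Set Plane} {g : ℝ → Plane} (hgK : ∀ θ, g θ ∈ K)
    (hsupp : ∀ θ, ∀ y ∈ K, ⟪y, normalDir θ⟫ ≤ ⟪g θ, normalDir θ⟫) {r : ℝ} (x : Plane) :
    K ⊆ closedBall x r ↔ ∀ θ, ⟪g θ - x, normalDir θ⟫ ≤ r := by
  constructor
  · intro h θ
    have h₁ := h (hgK θ)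
    rw [mem_closedBall, dist_eq_norm] at h₁
    simpa [norm_normalDir] using
      (real_inner_le_norm (g θ - x) (normalDir θ)).trans (by simpa [norm_normalDir] using h₁)
  · intro h y hy
    obtain ⟨θ, hθ⟩ := exists_normalDir_smul (y - x)
    have h₁ : ⟪y - x, normalDir θ⟫ = ‖y - x‖ := by
      conv_lhs => rw [hθ]
      rw [real_inner_smul_left, real_inner_self_eq_norm_sq, norm_normalDir]
      ring
    have h₂ := h θ
    have h₃ := hsupp θ y hy
    rw [mem_closedBall, dist_eq_norm, ← h₁]
    rw [inner_sub_left] at h₂ ⊢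
    linarith

/-- A curve lying on the frontier of a convex body and parametrized by its tangent angle is
supported by its normal directions. -/
lemma inner_normalDir_le_of_mem_frontier {K : Set Plane} (hK : IsClosed K) (hconv : Convex ℝ K)
    (hint : (interior K).Nonempty) {g : ℝ → Plane} {ρ : ℝ → ℝ} (hρ : ∀ t, 0 < ρ t)
    (hg : ∀ t, HasDerivAt g (ρ t • tangentDir t) t) (hfr : ∀ t, g t ∈ frontier K) (θ : ℝ) :
    ∀ y ∈ K, ⟪y, normalDir θ⟫ ≤ ⟪g θ, normalDir θ⟫ := by
  obtain ⟨f, hf, hmax⟩ := geometric_hahn_banach_of_nonempty_interior_point hconv (hfr θ).2 hint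
  set v : Plane := (InnerProductSpace.toDual ℝ Plane).symm f with hv
  have hfv : ∀ y, f y = ⟪y, v⟫ := fun y => by
    rw [real_inner_comm, hv, InnerProductSpace.toDual_symm_apply]
  obtain ⟨a, ha, hva⟩ := exists_pos_smul_normalDir hρ hg (θ := θ) (v := v) (by simpa [hv] using hf)
    fun t => by simpa only [hfv] using hmax _ (hK.frontier_subset (hfr t))
  intro y hy
  have := hmax y hy
  rw [hfv, hfv, hva, real_inner_smul_right, real_inner_smul_right] at this
  exact le_of_mul_le_mul_left this ha

/-- A unit-speed `C²` curve with curvature bounded below by a positive constant can be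
reparametrized by its tangent angle. -/
lemma exists_angle_reparametrization {γ : ℝ → Plane} (hγ : ContDiff ℝ 2 γ)
    (hspeed : ∀ s, ‖deriv γ s‖ = 1) {κ : ℝ → ℝ}
    (hκdef : ∀ s, κ s =
      deriv γ s 0 * deriv (deriv γ) s 1 - deriv γ s 1 * deriv (deriv γ) s 0)
    {κm : ℝ} (hκm : 0 < κm) (hκ : ∀ s, κm ≤ κ s) :
    Continuous κ ∧ ∃ θ g : ℝ → ℝ, (∀ s, g (θ s) = s) ∧ Continuous g ∧
      ∀ t, HasDerivAt (γ ∘ g) ((κ (g t))⁻¹ • tangentDir t) t := by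
  have h1 : ContDiff ℝ 1 (deriv γ) := (contDiff_succ_iff_deriv (n := 1)).1 hγ |>.2.2
  have h2 : Continuous (deriv (deriv γ)) := (contDiff_one_iff_deriv.1 h1).2
  have hd1 : ∀ s, HasDerivAt γ (deriv γ s) s := fun s =>
    (hγ.differentiable (by norm_num) s).hasDerivAt
  have hd2 : ∀ s, HasDerivAt (deriv γ) (deriv (deriv γ) s) s := fun s =>
    (h1.differentiable (by norm_num) s).hasDerivAt
  have hκc : Continuous κ := by
    rw [funext hκdef]
    have := h1.continuous
    fun_prop
  have hunit : ∀ s, deriv γ s 0 ^ 2 + deriv γ s 1 ^ 2 = 1 := fun s =>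
    (norm_eq_one_iff_plane _).1 (hspeed s)
  have horth : ∀ s, deriv γ s 0 * deriv (deriv γ) s 0 + deriv γ s 1 * deriv (deriv γ) s 1 = 0 := by
    intro s
    have h := (((hd2 s).plane_apply 0).pow 2).add (((hd2 s).plane_apply 1).pow 2)
    have h' := h.congr_of_eventuallyEq (f₁ := fun _ => (1 : ℝ))
      (Filter.Eventually.of_forall fun s => by simp [hunit s])
    have := h'.unique (hasDerivAt_const s (1 : ℝ))
    simp at this
    linarith
  have hfrenet₀ : ∀ s, deriv (deriv γ) s 0 = -(κ s * deriv γ s 1) := fun s => by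
    rw [hκdef]
    linear_combination deriv γ s 0 * horth s - deriv (deriv γ) s 0 * hunit s
  have hfrenet₁ : ∀ s, deriv (deriv γ) s 1 = κ s * deriv γ s 0 := fun s => by
    rw [hκdef]
    linear_combination deriv γ s 1 * horth s - deriv (deriv γ) s 1 * hunit s
  obtain ⟨α, hα⟩ : ∃ α, deriv γ 0 = tangentDir α := by
    obtain ⟨β, hβ⟩ := exists_normalDir_smul (deriv γ 0)
    rw [hspeed, one_smul] at hβ
    refine ⟨β - Real.pi / 2, hβ.trans (plane_ext ?_ ?_)⟩
    · simp [Real.sin_sub_pi_div_two]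
    · simp [Real.cos_sub_pi_div_two]
  obtain ⟨θ, hθ0, hθ⟩ := exists_antideriv hκc α
  have htan : ∀ s, deriv γ s = tangentDir (θ s) := by
    have hconst : ∀ s, HasDerivAt
        (fun s => deriv γ s 0 * -Real.sin (θ s) + deriv γ s 1 * Real.cos (θ s)) 0 s := fun s => by
      have h := (((hd2 s).plane_apply 0).mul (hθ s).sin.fun_neg).add
        (((hd2 s).plane_apply 1).mul (hθ s).cos)
      convert! h using 1
      rw [hfrenet₀, hfrenet₁]
      ring
    have hone : ∀ s, deriv γ s 0 * -Real.sin (θ s) + deriv γ s 1 * Real.cos (θ s) = 1 := fun s => by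
      rw [is_const_of_deriv_eq_zero (fun s => (hconst s).differentiableAt)
        (fun s => (hconst s).deriv) s 0, hα, hθ0]
      simp only [tangentDir_apply_zero, tangentDir_apply_one]
      linear_combination Real.sin_sq_add_cos_sq α
    intro s
    have h := hone s
    have hu := hunit s
    have hsc := Real.sin_sq_add_cos_sq (θ s)
    have hsum : (deriv γ s 0 + Real.sin (θ s)) ^ 2 + (deriv γ s 1 - Real.cos (θ s)) ^ 2 = 0 := by
      linear_combination hu + hsc - 2 * h
    refine plane_ext ?_ ?_
    · simp only [tangentDir_apply_zero]
      nlinarith [sq_nonneg (deriv γ s 0 + Real.sin (θ s)), sq_nonneg (deriv γ s 1 - Real.cos (θ s))]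
    · simp only [tangentDir_apply_one]
      nlinarith [sq_nonneg (deriv γ s 0 + Real.sin (θ s)), sq_nonneg (deriv γ s 1 - Real.cos (θ s))]
  obtain ⟨g, hgl, hgr, hg⟩ := exists_inverse_of_le_deriv hθ hκm hκ
  refine ⟨hκc, θ, g, hgl, continuous_iff_continuousAt.2 fun t => (hg t).continuousAt, fun t => ?_⟩
  have h := (hd1 (g t)).scomp t (hg t)
  rwa [htan, hgr] at h

/-- The reflection through the origin of a curve parametrized by its tangent angle has a `C²`
unit-speed parametrization whose curvature is the reciprocal of the radius of curvature. -/
lemma exists_unit_speed_reparametrization {c : ℝ → Plane} {σ : ℝ → ℝ} (hσ : Continuous σ) {m : ℝ}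
    (hm : 0 < m) (hmσ : ∀ t, m ≤ σ t) (hc : ∀ t, HasDerivAt c (σ t • tangentDir t) t) :
    ∃ φ : ℝ → ℝ, Function.Surjective φ ∧ ContDiff ℝ 2 (fun t => -c (φ t)) ∧
      (∀ t, ‖deriv (fun t => -c (φ t)) t‖ = 1) ∧
      ∀ t, deriv (fun t => -c (φ t)) t 0 * deriv (deriv fun t => -c (φ t)) t 1 -
        deriv (fun t => -c (φ t)) t 1 * deriv (deriv fun t => -c (φ t)) t 0 = (σ (φ t))⁻¹ := by
  obtain ⟨τ, -, hτ⟩ := exists_antideriv hσ 0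
  obtain ⟨φ, hφl, -, hφ⟩ := exists_inverse_of_le_deriv hτ hm hmσ
  have hpos : ∀ t, σ t ≠ 0 := fun t => (hm.trans_le (hmσ t)).ne'
  have hd1 : ∀ t, HasDerivAt (fun t => -c (φ t)) (-tangentDir (φ t)) t := fun t => by
    have h := ((hc (φ t)).scomp t (hφ t)).neg
    rwa [smul_smul, inv_mul_cancel₀ (hpos _), one_smul] at h
  have hderiv : deriv (fun t => -c (φ t)) = fun t => -tangentDir (φ t) :=
    funext fun t => (hd1 t).deriv
  have hd2 : ∀ t, HasDerivAt (fun t => -tangentDir (φ t)) ((σ (φ t))⁻¹ • normalDir (φ t)) t :=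
    fun t => by
      have h := ((hasDerivAt_tangentDir (φ t)).scomp t (hφ t)).neg
      rwa [smul_neg, neg_neg] at h
  have hderiv2 : deriv (fun t => -tangentDir (φ t)) = fun t => (σ (φ t))⁻¹ • normalDir (φ t) :=
    funext fun t => (hd2 t).deriv
  have hφc : Continuous φ := continuous_iff_continuousAt.2 fun t => (hφ t).continuousAt
  have hnc : Continuous normalDir :=
    continuous_iff_continuousAt.2 fun t => (hasDerivAt_normalDir t).continuousAt
  refine ⟨φ, fun t => ⟨τ t, hφl t⟩, ?_, fun t => ?_, fun t => ?_⟩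
  · refine (contDiff_succ_iff_deriv (n := 1)).2
      ⟨fun t => (hd1 t).differentiableAt, by simp, ?_⟩
    rw [hderiv, contDiff_one_iff_deriv, hderiv2]
    exact ⟨fun t => (hd2 t).differentiableAt,
      ((hσ.comp hφc).inv₀ fun t => hpos _).smul (hnc.comp hφc)⟩
  · rw [hderiv, norm_neg, norm_tangentDir]
  · rw [hderiv, hderiv2]
    simp only [PiLp.neg_apply, PiLp.smul_apply, smul_eq_mul, tangentDir_apply_zero,
      tangentDir_apply_one, normalDir_apply_zero, normalDir_apply_one]
    linear_combination (σ (φ t))⁻¹ * Real.sin_sq_add_cos_sq (φ t)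

/-- For a planar convex body `K` with `C²` boundary of curvature `κ ≥ κₘ > 0` and
`r > 1/κₘ`, the `r`-dual `K^{*,r} = {x : K ⊆ rB² + x}` has `C²` boundary (it admits a
`C²` unit-speed parametrization `δ` with curvature `κ*`), and whenever `v` is the outer
unit normal of `K` at `γ s` and `-v` is the outer unit normal of `K^{*,r}` at `δ t`,
one has `1/κ(γ s) + 1/κ*(δ t) = r`. -/
theorem curvature_of_r_dual
    (K : Set (EuclideanSpace ℝ (Fin 2)))
    (hKcomp : IsCompact K) (hKconv : Convex ℝ K) (hKint : (interior K).Nonempty)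
    (γ : ℝ → EuclideanSpace ℝ (Fin 2)) (hγ : ContDiff ℝ 2 γ)
    (hγspeed : ∀ s, ‖deriv γ s‖ = 1)
    (hγrange : frontier K = Set.range γ)
    (κ : ℝ → ℝ)
    (hκdef : ∀ s, κ s =
      deriv γ s 0 * deriv (deriv γ) s 1 - deriv γ s 1 * deriv (deriv γ) s 0)
    (κm : ℝ) (hκm : 0 < κm) (hκ : ∀ s, κm ≤ κ s)
    (r : ℝ) (hr : 1 / κm < r) :
    ∃ (δ : ℝ → EuclideanSpace ℝ (Fin 2)) (κs : ℝ → ℝ),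
      ContDiff ℝ 2 δ ∧ (∀ t, ‖deriv δ t‖ = 1) ∧
      frontier {x | K ⊆ closedBall x r} = Set.range δ ∧
      (∀ t, κs t =
        deriv δ t 0 * deriv (deriv δ) t 1 - deriv δ t 1 * deriv (deriv δ) t 0) ∧
      ∀ (s t : ℝ) (v : EuclideanSpace ℝ (Fin 2)), ‖v‖ = 1 →
        (∀ y ∈ K, ⟪y - γ s, v⟫ ≤ 0) →
        (∀ y ∈ {x | K ⊆ closedBall x r}, ⟪y - δ t, -v⟫ ≤ 0) →
        1 / κ s + 1 / κs t = r := by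
  obtain ⟨hκc, θ, g, hgθ, hgc, hp⟩ := exists_angle_reparametrization hγ hγspeed hκdef hκm hκ
  have hκpos : ∀ s, 0 < κ s := fun s => hκm.trans_le (hκ s)
  set p : ℝ → Plane := γ ∘ g with hpdef
  set ρ : ℝ → ℝ := fun t => (κ (g t))⁻¹ with hρdef
  have hρpos : ∀ t, 0 < ρ t := fun t => inv_pos.2 (hκpos _)
  have hpfr : ∀ t, p t ∈ frontier K := fun t => by
    rw [hγrange]
    exact ⟨g t, rfl⟩
  have hpK : ∀ t, p t ∈ K := fun t => hKcomp.isClosed.frontier_subset (hpfr t)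
  have hpγ : ∀ s, p (θ s) = γ s := fun s => by simp only [hpdef, Function.comp_apply, hgθ]
  have hsupp := inner_normalDir_le_of_mem_frontier hKcomp.isClosed hKconv hKint hρpos hp hpfr
  have hpper : Function.Periodic p (2 * Real.pi) :=
    periodic_of_inner_normalDir_le hp fun t u => hsupp t _ (hpK u)
  have hρper : Function.Periodic ρ (2 * Real.pi) := periodic_speed hp hpper
  set c : ℝ → Plane := fun t => r • normalDir t - p t with hcdef
  set σ : ℝ → ℝ := fun t => r - ρ t with hσdef
  have hc : ∀ t, HasDerivAt c (σ t • tangentDir t) t := fun t => by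
    have h := ((hasDerivAt_normalDir t).const_smul r).sub (hp t)
    rwa [← sub_smul] at h
  have hcper : Function.Periodic c (2 * Real.pi) := fun t => by
    simp only [hcdef, hpper t, normalDir_periodic t]
  have hσc : Continuous σ :=
    continuous_const.sub ((hκc.comp hgc).inv₀ fun t => (hκpos _).ne')
  have hσm : ∀ t, r - 1 / κm ≤ σ t := fun t => by
    have : (κ (g t))⁻¹ ≤ 1 / κm := by
      rw [one_div]
      exact inv_anti₀ hκm (hκ _)
    simp only [hσdef, hρdef]
    linarith
  have hσpos : ∀ t, 0 < σ t := fun t => (sub_pos.2 hr).trans_le (hσm t)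
  obtain ⟨φ, hφs, hδ, hδspeed, hδκ⟩ :=
    exists_unit_speed_reparametrization hσc (sub_pos.2 hr) hσm hc
  have hcle : ∀ t u, ⟪c u, normalDir t⟫ ≤ ⟪c t, normalDir t⟫ := inner_normalDir_le hσpos hc hcper
  have hdual : {x | K ⊆ closedBall x r} =
      Neg.neg ⁻¹' {x : Plane | ∀ t, ⟪x, normalDir t⟫ ≤ ⟪c t, normalDir t⟫} := by
    ext x
    simp only [Set.mem_preimage, Set.mem_ofPred_eq, subset_closedBall_iff hpK hsupp]
    refine forall_congr' fun t => ?_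
    rw [hcdef, inner_sub_left, inner_sub_left, inner_neg_left, real_inner_smul_left,
      real_inner_self_eq_norm_sq, norm_normalDir]
    constructor <;> intro h <;> linarith
  have hfr : frontier {x | K ⊆ closedBall x r} = Set.range fun t => -c (φ t) := by
    have h := (Homeomorph.neg Plane).preimage_frontier
      {x : Plane | ∀ t, ⟪x, normalDir t⟫ ≤ ⟪c t, normalDir t⟫}
    rw [Homeomorph.coe_neg] at h
    rw [hdual, ← h, frontier_setOf_inner_le hc hcper hcle]
    ext x
    simp only [Set.mem_preimage, Set.mem_range]
    constructor
    · rintro ⟨t, ht⟩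
      obtain ⟨u, rfl⟩ := hφs t
      exact ⟨u, by rw [ht, neg_neg]⟩
    · rintro ⟨u, rfl⟩
      exact ⟨φ u, by rw [neg_neg]⟩
  refine ⟨fun t => -c (φ t), fun t => (σ (φ t))⁻¹, hδ, hδspeed, hfr, fun t => (hδκ t).symm, ?_⟩
  intro s t v hv hvK hvdual
  have h₁ : v = normalDir (θ s) := by
    refine eq_normalDir_of_inner_le hρpos hp hv fun u => ?_
    have h := hvK _ (hpK u)
    rw [inner_sub_left] at h
    rw [hpγ]
    linarith
  have h₂ : v = normalDir (φ t) := by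
    refine eq_normalDir_of_inner_le hσpos hc hv fun u => ?_
    have hmem : -c u ∈ {x | K ⊆ closedBall x r} := by
      rw [hdual]
      intro w
      simpa only [neg_neg] using hcle w u
    have h := hvdual _ hmem
    rw [inner_sub_left, inner_neg_neg, inner_neg_neg] at h
    linarith
  have h₃ : ρ (θ s) = ρ (φ t) := apply_eq_of_normalDir_eq hρper (h₁.symm.trans h₂)
  have h₄ : 1 / κ s = ρ (θ s) := by simp only [hρdef, hgθ, one_div]
  rw [h₄, h₃, one_div, inv_inv]
  simp only [hσdef]
  ring
end
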